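/- arXiv:2503.03949 — 15 statements merged into one kernel-verified Lean document; each statement's English description precedes it below -/
import Mathlib

section
/- The matrix B has exactly one negative eigenvalue and exactly l−1 positive eigenvalues, counted with multiplicity; equivalently, the real quadratic form x ↦ xᵀBx on ℝ^l has signature (l−1, 1). In particular B is invertible. -/
open Matrix Polynomial

theorem Matrix.IsHermitian.dotProduct_mulVec_combination_eigenvectors
    {ι : Type*} [Fintype ι] [DecidableEq ι] {A : Matrix ι ι ℝ} (hA : A.IsHermitian)
    {i j : ι} (hij : i ≠ j) (a b : ℝ) :
    let x := a • (hA.eigenvectorBasis i).ofLp + b • (hA.eigenvectorBasis j).ofLp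
    x ⬝ᵥ A *ᵥ x = a ^ 2 * hA.eigenvalues i + b ^ 2 * hA.eigenvalues j ∧
      x ⬝ᵥ x = a ^ 2 + b ^ 2 := by
  have horth : ∀ p q, (hA.eigenvectorBasis p).ofLp ⬝ᵥ (hA.eigenvectorBasis q).ofLp =
      if p = q then 1 else 0 := by
    intro p q
    have h := orthonormal_iff_ite.mp hA.eigenvectorBasis.orthonormal q p
    rw [EuclideanSpace.inner_eq_star_dotProduct] at h
    simpa [eq_comm] using h
  simp only [mulVec_add, mulVec_smul, hA.mulVec_eigenvectorBasis, add_dotProduct, dotProduct_add,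
    smul_dotProduct, dotProduct_smul, horth, hij, hij.symm, if_true, if_false, smul_eq_mul]
  constructor <;> ring

/-- A real symmetric matrix which is positive on the nonzero vectors of a hyperplane and negative
somewhere has one negative eigenvalue, all the others being positive. -/
theorem Matrix.IsHermitian.exists_eigenvalues_neg_forall_ne_pos
    {ι : Type*} [Fintype ι] [DecidableEq ι] {A : Matrix ι ι ℝ} (hA : A.IsHermitian)
    (f : (ι → ℝ) →ₗ[ℝ] ℝ) (hpos : ∀ x, x ≠ 0 → f x = 0 → 0 < x ⬝ᵥ A *ᵥ x)
    {y : ι → ℝ} (hy : y ⬝ᵥ A *ᵥ y < 0) :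
    ∃ i, hA.eigenvalues i < 0 ∧ ∀ j, j ≠ i → 0 < hA.eigenvalues j := by
  obtain ⟨i, hi⟩ : ∃ i, hA.eigenvalues i < 0 := by
    by_contra! h
    have hpsd := hA.posSemidef_iff_eigenvalues_nonneg.mpr h
    have := hpsd.dotProduct_mulVec_nonneg y
    rw [star_trivial] at this
    linarith
  refine ⟨i, hi, fun j hji => ?_⟩
  by_contra! hj
  have key : ∀ a b : ℝ, 0 < a ^ 2 + b ^ 2 →
      a * f (hA.eigenvectorBasis i).ofLp + b * f (hA.eigenvectorBasis j).ofLp ≠ 0 := by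
    intro a b hab hf
    obtain ⟨h₁, h₂⟩ := hA.dotProduct_mulVec_combination_eigenvectors hji.symm a b
    have := hpos (a • (hA.eigenvectorBasis i).ofLp + b • (hA.eigenvectorBasis j).ofLp)
      (by
        intro h
        rw [h, zero_dotProduct] at h₂
        exact hab.ne h₂)
      (by simpa using hf)
    rw [h₁] at this
    nlinarith [mul_nonneg (sq_nonneg a) (neg_nonneg.mpr hi.le),
      mul_nonneg (sq_nonneg b) (neg_nonneg.mpr hj)]
  have hfi : f (hA.eigenvectorBasis i).ofLp ≠ 0 := by simpa using key 1 0 (by norm_num)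
  refine key (-f (hA.eigenvectorBasis j).ofLp) (f (hA.eigenvectorBasis i).ofLp) ?_ (by ring)
  positivity

theorem Matrix.IsHermitian.card_roots_charpoly_of_eigenvalues
    {ι : Type*} [Fintype ι] [DecidableEq ι] {A : Matrix ι ι ℝ} (hA : A.IsHermitian)
    {i : ι} (hi : hA.eigenvalues i < 0) (hpos : ∀ j, j ≠ i → 0 < hA.eigenvalues j) :
    Multiset.card A.charpoly.roots = Fintype.card ι ∧
    Multiset.card (A.charpoly.roots.filter fun x => x < 0) = 1 ∧
    Multiset.card (A.charpoly.roots.filter fun x => 0 < x) = Fintype.card ι - 1 ∧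
    IsUnit A.det := by
  have hneg_iff : ∀ j, hA.eigenvalues j < 0 ↔ j = i := fun j =>
    ⟨fun h => by_contra fun hj => (hpos j hj).not_gt h, fun h => h ▸ hi⟩
  have hpos_iff : ∀ j, 0 < hA.eigenvalues j ↔ j ≠ i := fun j =>
    ⟨fun h hj => (hj ▸ hi).not_gt h, hpos j⟩
  have hroots : A.charpoly.roots = Finset.univ.val.map hA.eigenvalues := by
    simpa using hA.roots_charpoly_eq_eigenvalues
  refine ⟨?_, ?_, ?_, ?_⟩
  · simp [hroots]
  · rw [hroots, Multiset.filter_map, Multiset.card_map]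
    simp only [Function.comp_def, hneg_iff]
    rw [← Finset.filter_val, Finset.card_val, Finset.filter_eq']
    simp
  · rw [hroots, Multiset.filter_map, Multiset.card_map]
    simp only [Function.comp_def, hpos_iff]
    rw [← Finset.filter_val, Finset.card_val, Finset.filter_ne']
    simp
  · rw [hA.det_eq_prod_eigenvalues, isUnit_iff_ne_zero]
    refine Finset.prod_ne_zero_iff.mpr fun j _ => ?_
    by_cases hj : j = i
    · simpa [hj] using hi.ne
    · simpa using (hpos j hj).ne'

theorem sum_sum_mul_ite_eq_sum_sq {ι κ : Type*} [Fintype ι] [Fintype κ] [DecidableEq κ]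
    (b : ι → κ) (x : ι → ℝ) :
    ∑ i, ∑ j, (if b i = b j then x i * x j else 0) =
      ∑ c, (∑ i, if b i = c then x i else 0) ^ 2 := by
  simp_rw [sq, Finset.sum_mul_sum]
  conv_rhs => rw [Finset.sum_comm]
  refine Finset.sum_congr rfl fun i _ => ?_
  conv_rhs => rw [Finset.sum_comm]
  refine Finset.sum_congr rfl fun j _ => ?_
  simp only [mul_ite, ite_mul, zero_mul, mul_zero]
  rw [Finset.sum_eq_single (b i)]
  · simp [eq_comm]
  · intro c _ hc
    simp [hc.symm]
  · simp

/-- The block matrix `B` (diagonal 1, `-n` within blocks, `-(n+1/2)` across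
blocks) has exactly one negative eigenvalue and `l-1` positive eigenvalues counted with
multiplicity; in particular all eigenvalues are real and `B` is invertible. -/
theorem signature_of_B
    (n k : ℕ) (hn : 1 ≤ n) (hk : 1 ≤ k)
    (α : Fin k → ℕ) (hα : ∀ i, 0 < α i)
    (l : ℕ) (hl : l = ∑ i, α i) (hl2 : 2 ≤ l)
    (hexc : ¬(n = 1 ∧ k = 1 ∧ l = 2))
    (blk : Fin l → Fin k) (hmono : Monotone blk)
    (hcard : ∀ j, (Finset.univ.filter fun i => blk i = j).card = α j)
    (B : Matrix (Fin l) (Fin l) ℝ)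
    (hB : ∀ i j, B i j =
      if i = j then 1 else if blk i = blk j then -(n : ℝ) else -((n : ℝ) + 1 / 2)) :
    Multiset.card B.charpoly.roots = l ∧
    Multiset.card (B.charpoly.roots.filter fun x => x < 0) = 1 ∧
    Multiset.card (B.charpoly.roots.filter fun x => 0 < x) = l - 1 ∧
    IsUnit B.det := by
  have hherm : B.IsHermitian := by
    ext i j
    simp [hB, eq_comm]
  have hform : ∀ x : Fin l → ℝ, x ⬝ᵥ B *ᵥ x = (n + 1) * ∑ i, x i ^ 2
      + 1 / 2 * ∑ c, (∑ i, if blk i = c then x i else 0) ^ 2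
      - (n + 1 / 2) * (∑ i, x i) ^ 2 := by
    intro x
    have hterm : ∀ i j, x i * (B i j * x j) = (n + 1) * (if i = j then x i * x j else 0)
        + 1 / 2 * (if blk i = blk j then x i * x j else 0) - (n + 1 / 2) * (x i * x j) := by
      intro i j
      rw [hB]
      by_cases hij : i = j
      · subst hij
        simp only [if_true]
        ring
      · simp only [hij, if_false]
        split_ifs <;> ring
    rw [← sum_sum_mul_ite_eq_sum_sq, sq (∑ i, x i), Finset.sum_mul_sum]
    simp only [dotProduct, mulVec, Finset.mul_sum, hterm, Finset.sum_sub_distrib,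
      Finset.sum_add_distrib]
    simp [sq]
  have hpos : ∀ x : Fin l → ℝ, x ≠ 0 → (∑ i, LinearMap.proj i : (Fin l → ℝ) →ₗ[ℝ] ℝ) x = 0 →
      0 < x ⬝ᵥ B *ᵥ x := by
    intro x hx hsum
    have hsum' : ∑ i, x i = 0 := by simpa using hsum
    obtain ⟨i, hi⟩ := Function.ne_iff.mp hx
    have hsq : 0 < ∑ i, x i ^ 2 :=
      Finset.sum_pos' (fun _ _ => sq_nonneg _) ⟨i, Finset.mem_univ _, sq_pos_of_ne_zero hi⟩
    rw [hform, hsum']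
    have : 0 ≤ ∑ c, (∑ i, if blk i = c then x i else 0) ^ 2 :=
      Finset.sum_nonneg fun _ _ => sq_nonneg _
    have : 0 < ((n : ℝ) + 1) * ∑ i, x i ^ 2 := by positivity
    linarith
  have hneg : (1 : Fin l → ℝ) ⬝ᵥ B *ᵥ 1 < 0 := by
    by_cases hnl : n = 1 ∧ l = 2
    · obtain ⟨rfl, rfl⟩ := hnl
      have hk2 : 1 < Fintype.card (Fin k) := by simp; omega
      have : Nontrivial (Fin k) := Fintype.one_lt_card_iff_nontrivial.mp hk2
      obtain ⟨c, hc⟩ := exists_ne (blk 0)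
      obtain ⟨i, hi⟩ := Finset.card_pos.mp ((hcard c).symm ▸ hα c)
      have hi' : blk i = c := by simpa using hi
      have h01 : blk 0 ≠ blk 1 := by
        intro h
        fin_cases i
        · exact hc hi'.symm
        · exact hc (hi'.symm.trans h.symm)
      simp [dotProduct, mulVec, Fin.sum_univ_two, hB, h01, h01.symm]
    · have hle : ∀ i j, B i j ≤ (n + 1) * (if i = j then 1 else 0) - n := by
        intro i j
        rw [hB]
        split_ifs <;> linarith
      have hsum : (1 : Fin l → ℝ) ⬝ᵥ B *ᵥ 1 ≤
          ∑ i : Fin l, ∑ j : Fin l, (((n : ℝ) + 1) * (if i = j then 1 else 0) - n) := by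
        simp only [dotProduct, mulVec, Pi.one_apply, one_mul, mul_one]
        exact Finset.sum_le_sum fun i _ => Finset.sum_le_sum fun j _ => hle i j
      have hval : ∑ i : Fin l, ∑ j : Fin l, (((n : ℝ) + 1) * (if i = j then 1 else 0) - n) =
          l * (n + 1 - n * l) := by
        simp [Finset.sum_sub_distrib]
        ring
      have hlt : n + 1 < n * l := by
        obtain ⟨m, rfl⟩ := Nat.exists_eq_add_of_le hl2
        rcases Nat.lt_or_ge 1 n with h | h
        · nlinarith
        · obtain rfl : n = 1 := le_antisymm h hn
          omega
      have hlt' : (n : ℝ) + 1 < n * l := by exact_mod_cast hlt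
      have hl0 : (0 : ℝ) < l := by exact_mod_cast (by omega : 0 < l)
      rw [hval] at hsum
      nlinarith
  obtain ⟨i, hi, hother⟩ := hherm.exists_eigenvalues_neg_forall_ne_pos _ hpos hneg
  simpa only [Fintype.card_fin] using hherm.card_roots_charpoly_of_eigenvalues hi hother
end

section
/- For all real t, det(B − t·I_l) = (1 + n − t)^{l−k} · det(A − t·I_k); equivalently, the characteristic polynomial of B is (1 + n − t)^{l−k} times the characteristic polynomial of A. -/
open Matrix Polynomial

/-- Scaled Weinstein–Aronszajn identity for rectangular factors. -/
theorem Matrix.det_smul_one_add_mul_comm_of_le {R m n : Type*} [CommRing R]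
    [Fintype m] [DecidableEq m] [Fintype n] [DecidableEq n]
    (P : Matrix m n R) (Q : Matrix n m R) (hle : Fintype.card n ≤ Fintype.card m) (c : R) :
    (c • (1 : Matrix m m R) + P * Q).det =
      c ^ (Fintype.card m - Fintype.card n) * (c • (1 : Matrix n n R) + Q * P).det := by
  have h := congrArg (Polynomial.eval c) (Matrix.charpoly_mul_comm_of_le P (-Q) hle)
  simpa [Matrix.eval_charpoly, Matrix.smul_one_eq_diagonal] using h

/-- `det(B - t·I) = (1 + n - t)^(l-k) · det(A - t·I)` for all real `t`,
where `B` is the block matrix and `A` the reduced `k × k` matrix. -/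
theorem charpoly_B_factorization
    (n k : ℕ) (hn : 1 ≤ n) (hk : 1 ≤ k)
    (α : Fin k → ℕ) (hα : ∀ i, 0 < α i)
    (l : ℕ) (hl : l = ∑ i, α i)
    (blk : Fin l → Fin k) (hmono : Monotone blk)
    (hcard : ∀ j, (Finset.univ.filter fun i => blk i = j).card = α j)
    (B : Matrix (Fin l) (Fin l) ℝ)
    (hB : ∀ i j, B i j =
      if i = j then 1 else if blk i = blk j then -(n : ℝ) else -((n : ℝ) + 1 / 2))
    (A : Matrix (Fin k) (Fin k) ℝ)
    (hA : ∀ i j, A i j =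
      if i = j then 1 - ((α i : ℝ) - 1) * n else -((n : ℝ) + 1 / 2) * α j) :
    ∀ t : ℝ,
      (B - t • (1 : Matrix (Fin l) (Fin l) ℝ)).det =
        (1 + (n : ℝ) - t) ^ (l - k) * (A - t • (1 : Matrix (Fin k) (Fin k) ℝ)).det := by
  intro t
  let P : Matrix (Fin l) (Fin k) ℝ := Matrix.of fun i a => if blk i = a then 1 else 0
  let C : Matrix (Fin k) (Fin k) ℝ :=
    Matrix.of fun a b => if a = b then -(n : ℝ) else -((n : ℝ) + 1 / 2)
  have hkl : k ≤ l := by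
    simpa [hl] using Finset.sum_le_sum fun i (_ : i ∈ Finset.univ) => Nat.succ_le_of_lt (hα i)
  have hPP : Pᵀ * P = Matrix.diagonal fun a => (α a : ℝ) := by
    ext a b
    simp only [P, Matrix.mul_apply, Matrix.transpose_apply, Matrix.of_apply,
      Matrix.diagonal_apply, ← hcard]
    by_cases hab : a = b
    · subst hab
      simp [← ite_and]
    · rw [if_neg hab]
      refine Finset.sum_eq_zero fun i _ => ?_
      by_cases hi : blk i = a
      · simp [hi, hab]
      · simp [hi]
  have hBP : B - t • (1 : Matrix (Fin l) (Fin l) ℝ) =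
      (1 + (n : ℝ) - t) • (1 : Matrix (Fin l) (Fin l) ℝ) + P * (C * Pᵀ) := by
    ext i j
    have hPC : (P * (C * Pᵀ)) i j = C (blk i) (blk j) := by
      simp [P, Matrix.mul_apply]
    rw [Matrix.add_apply, hPC]
    by_cases hij : i = j
    · subst hij
      simp [hB, C]
      ring
    · simp [hB, C, hij]
  have hAC : A - t • (1 : Matrix (Fin k) (Fin k) ℝ) =
      (1 + (n : ℝ) - t) • (1 : Matrix (Fin k) (Fin k) ℝ) + C * Pᵀ * P := by
    rw [Matrix.mul_assoc, hPP]
    ext a b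
    by_cases hab : a = b
    · subst hab
      simp [hA, C]
      ring
    · simp [hA, C, hab]
  rw [hBP, hAC, Matrix.det_smul_one_add_mul_comm_of_le P (C * Pᵀ) (by simpa using hkl)]
  simp
end

section
/- For all real t, det(A − t·I_k) = (1 − (α_1 − 1)n − Σ_{i=2}^{k} (n + 1/2)α_i − t) · ∏_{i=2}^{k} (1 + n + α_i/2 − t) + Σ_{i=2}^{k} (n + 1/2)α_i · (α_i − α_1)/2 · ∏_{j=2, j≠i}^{k} (1 + n + α_j/2 − t), where empty products equal 1. -/
open Matrix Polynomial Finset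

/-- Adding a fixed vector `v` to the rows indexed by `s` of a diagonal matrix. -/
theorem det_diagonal_add_ite_row {m R : Type*} [Fintype m] [DecidableEq m] [CommRing R]
    (d v : m → R) (s : Finset m) :
    (diagonal d + of fun i j => if i ∈ s then v j else 0).det =
      ∏ i, d i + ∑ i ∈ s, v i * ∏ j ∈ univ.erase i, d j := by
  induction s using Finset.induction_on with
  | empty =>
    have h : (diagonal d + of fun i j => if i ∈ (∅ : Finset m) then v j else 0) =
        diagonal d := by
      ext i j
      simp
    rw [h, det_diagonal, sum_empty, add_zero]
  | insert i s hi ih =>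
    set M : Matrix m m R := diagonal d + of fun i j => if i ∈ s then v j else 0 with hM
    have hsplit : (diagonal d + of fun a j => if a ∈ insert i s then v j else 0) =
        M.updateRow i (M i + v) := by
      ext a b
      by_cases hab : a = i
      · subst hab
        simp [hM, hi]
      · simp [hM, hab]
    have hclear : (M.updateRow i v).det = ((diagonal d).updateRow i v).det := by
      refine det_eq_of_forall_row_eq_smul_add_const (fun a => if a ∈ s then 1 else 0) i
        (by simp [hi]) fun a b => ?_
      by_cases hab : a = i
      · subst hab
        simp [hi]
      · simp [hM, hab]
    rw [hsplit, det_updateRow_add, updateRow_eq_self, ih, hclear, ← cramer_transpose_apply,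
      cramer_eq_adjugate_mulVec, diagonal_transpose, adjugate_diagonal, mulVec_diagonal,
      sum_insert hi]
    ring

/-- explicit Laplace-expansion formula for the characteristic
polynomial `det(A - t·I)` of the reduced matrix `A`. The index `⟨0, hk⟩` plays the
role of the first index `i = 1`, and sums/products over `Finset.univ.erase ⟨0, hk⟩`
correspond to `i = 2, …, k` (empty products equal 1). -/
theorem charpoly_A_formula
    (n k : ℕ) (hn : 1 ≤ n) (hk : 0 < k)
    (α : Fin k → ℕ) (hα : ∀ i, 0 < α i)
    (A : Matrix (Fin k) (Fin k) ℝ)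
    (hA : ∀ i j, A i j =
      if i = j then 1 - ((α i : ℝ) - 1) * n else -((n : ℝ) + 1 / 2) * α j) :
    ∀ t : ℝ,
      (A - t • (1 : Matrix (Fin k) (Fin k) ℝ)).det =
        (1 - ((α ⟨0, hk⟩ : ℝ) - 1) * n
            - (∑ i ∈ Finset.univ.erase (⟨0, hk⟩ : Fin k), ((n : ℝ) + 1 / 2) * α i) - t)
          * ∏ i ∈ Finset.univ.erase (⟨0, hk⟩ : Fin k), (1 + (n : ℝ) + (α i : ℝ) / 2 - t)
        + ∑ i ∈ Finset.univ.erase (⟨0, hk⟩ : Fin k),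
            ((n : ℝ) + 1 / 2) * α i * (((α i : ℝ) - (α ⟨0, hk⟩ : ℝ)) / 2)
              * ∏ j ∈ (Finset.univ.erase (⟨0, hk⟩ : Fin k)).erase i,
                  (1 + (n : ℝ) + (α j : ℝ) / 2 - t) := by
  intro t
  set z : Fin k := ⟨0, hk⟩
  set c : ℝ := (n : ℝ) + 1 / 2 with hc
  set d : Fin k → ℝ := fun i => 1 + (n : ℝ) + (α i : ℝ) / 2 - t with hd
  have hmat : A - t • (1 : Matrix (Fin k) (Fin k) ℝ) =
      diagonal d + of fun i j => if i ∈ univ then -c * α j else 0 := by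
    ext i j
    by_cases hij : i = j
    · subst hij
      simp [hA, hd, hc]
      ring
    · simp [hA, hij, hc]
  have hprod : ∏ i, d i = d z * ∏ i ∈ univ.erase z, d i :=
    (mul_prod_erase _ _ (mem_univ z)).symm
  have hterm : ∀ i ∈ univ.erase z, -c * α i * ∏ j ∈ univ.erase i, d j =
      c * α i * ((α i - α z) / 2) * ∏ j ∈ (univ.erase z).erase i, d j
        - c * α i * ∏ j ∈ univ.erase z, d j := by
    intro i hi
    have hz : z ∈ univ.erase i := mem_erase.2 ⟨(ne_of_mem_erase hi).symm, mem_univ z⟩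
    rw [← mul_prod_erase _ _ hz, ← mul_prod_erase _ _ hi, erase_right_comm]
    simp only [hd]
    ring
  rw [hmat, det_diagonal_add_ite_row, ← add_sum_erase _ _ (mem_univ z), sum_congr rfl hterm,
    sum_sub_distrib, ← sum_mul, hprod]
  simp only [hd, hc]
  ring
end

section
/- det(A) < 0. -/
open Matrix

/-- The determinant of a rank-one perturbation of an invertible diagonal matrix. -/
theorem det_diagonal_add_mul {ι K : Type*} [Fintype ι] [DecidableEq ι] [Field K]
    (d u v : ι → K) (hd : ∀ i, d i ≠ 0) :
    (Matrix.of fun i j => (if i = j then d i else 0) + u i * v j).det =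
      (∏ i, d i) * (1 + ∑ i, v i * (u i / d i)) := by
  have h : (Matrix.of fun i j => (if i = j then d i else 0) + u i * v j) =
      diagonal d * (1 + replicateCol Unit (fun i => u i / d i) * replicateRow Unit v) := by
    ext i j
    have := hd i
    rw [diagonal_mul]
    by_cases hij : i = j
    · subst hij
      simp [Matrix.mul_apply]
      field_simp
    · simp [Matrix.mul_apply, hij]
      field_simp
  rw [h, det_mul, det_diagonal, det_one_add_replicateCol_mul_replicateRow]
  rfl

/-- `det A < 0` for the reduced matrix `A`, given `l = Σ αᵢ ≥ 2` and
excluding the case `n = 1, k = 1, l = 2`. -/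
theorem detA_neg
    (n k : ℕ) (hn : 1 ≤ n) (hk : 1 ≤ k)
    (α : Fin k → ℕ) (hα : ∀ i, 0 < α i)
    (l : ℕ) (hl : l = ∑ i, α i) (hl2 : 2 ≤ l)
    (hexc : ¬(n = 1 ∧ k = 1 ∧ l = 2))
    (A : Matrix (Fin k) (Fin k) ℝ)
    (hA : ∀ i j, A i j =
      if i = j then 1 - ((α i : ℝ) - 1) * n else -((n : ℝ) + 1 / 2) * α j) :
    A.det < 0 := by
  have hn' : (1 : ℝ) ≤ n := by exact_mod_cast hn
  have hd : ∀ i, (0 : ℝ) < 1 + n + α i / 2 := fun i => by positivity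
  have hA' : A = Matrix.of fun i j =>
      (if i = j then 1 + (n : ℝ) + α i / 2 else 0) + -((n : ℝ) + 1 / 2) * α j := by
    ext i j
    rw [hA, of_apply]
    split_ifs with hij
    · subst hij
      ring
    · ring
  rw [hA', det_diagonal_add_mul _ (fun _ => -((n : ℝ) + 1 / 2)) (fun j => (α j : ℝ))
    fun i => (hd i).ne']
  refine mul_neg_of_pos_of_neg (Finset.prod_pos fun i _ => hd i) ?_
  obtain rfl | hk2 : k = 1 ∨ 2 ≤ k := by omega
  · simp only [Finset.univ_unique, Fin.default_eq_zero, Finset.sum_singleton] at hl ⊢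
    have key : n + 2 ≤ n * α 0 := by
      rw [← hl]
      obtain h | rfl : 3 ≤ l ∨ l = 2 := by omega
      · nlinarith
      · omega
    have key' : (n : ℝ) + 2 ≤ n * α 0 := by exact_mod_cast key
    have h : (α 0 : ℝ) * (-((n : ℝ) + 1 / 2) / (1 + n + α 0 / 2)) < -1 := by
      rw [← mul_div_assoc, div_lt_iff₀ (hd 0)]
      nlinarith
    linarith
  · have hterm : ∀ i, (α i : ℝ) * (-((n : ℝ) + 1 / 2) / (1 + n + α i / 2)) ≤ -(3 / 5) := by
      intro i
      have h1 : (1 : ℝ) ≤ α i := by exact_mod_cast hα i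
      rw [← mul_div_assoc, div_le_iff₀ (hd i)]
      nlinarith
    have hsum := Finset.sum_le_card_nsmul Finset.univ _ _ fun i _ => hterm i
    have hk' : (2 : ℝ) ≤ k := by exact_mod_cast hk2
    simp only [Finset.card_univ, Fintype.card_fin, nsmul_eq_mul] at hsum
    linarith
end

section
/- Every eigenvalue of A is real and nonzero, and A has exactly one negative eigenvalue and exactly k−1 positive eigenvalues, counted with multiplicity (i.e., the characteristic polynomial of A has k real roots with multiplicity, exactly one of which is negative). -/
open Matrix Polynomial

/-- The quadratic form of a diagonal matrix minus a rank-one matrix. -/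
theorem dotProduct_diagonal_sub_vecMulVec_mulVec {ι : Type*} [Fintype ι] [DecidableEq ι]
    (d s w : ι → ℝ) (c : ℝ) :
    w ⬝ᵥ ((diagonal d - c • vecMulVec s s) *ᵥ w) = ∑ i, d i * w i ^ 2 - c * (s ⬝ᵥ w) ^ 2 := by
  have h : (diagonal d - c • vecMulVec s s) *ᵥ w = fun i => d i * w i - c * (s ⬝ᵥ w) * s i := by
    ext i
    simp [sub_mulVec, smul_mulVec, vecMulVec_mulVec, mulVec_diagonal]
    ring
  rw [h]
  have h2 : c * (s ⬝ᵥ w) ^ 2 = ∑ i, c * (s ⬝ᵥ w) * (s i * w i) := by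
    rw [← Finset.mul_sum]
    simp only [dotProduct]
    ring
  rw [h2, ← Finset.sum_sub_distrib]
  exact Finset.sum_congr rfl fun i _ => by ring

theorem isHermitian_diagonal_sub_vecMulVec {ι : Type*} [DecidableEq ι] (d s : ι → ℝ) (c : ℝ) :
    (diagonal d - c • vecMulVec s s).IsHermitian := by
  ext i j
  by_cases h : i = j
  · subst h
    simp
  · simp [vecMulVec_apply, h, Ne.symm h, mul_comm (s i)]

/-- A rank-one perturbation of a positive diagonal matrix has at most one nonpositive
eigenvalue. -/
theorem eigenvalues_pos_of_ne {ι : Type*} [Fintype ι] [DecidableEq ι] {d s : ι → ℝ} {c : ℝ}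
    (hd : ∀ i, 0 < d i) (hS : (diagonal d - c • vecMulVec s s).IsHermitian) {i j : ι}
    (hij : j ≠ i) (hi : hS.eigenvalues i ≤ 0) : 0 < hS.eigenvalues j := by
  by_contra! hj
  set u : ι → ℝ := ⇑(hS.eigenvectorBasis i) with hu
  set v : ι → ℝ := ⇑(hS.eigenvectorBasis j) with hv
  have inner_eq (p q : ι) : ⇑(hS.eigenvectorBasis p) ⬝ᵥ ⇑(hS.eigenvectorBasis q)
      = if q = p then 1 else 0 := by
    rw [← orthonormal_iff_ite.mp hS.eigenvectorBasis.orthonormal q p]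
    simp [PiLp.inner_apply, dotProduct]
  have huu : u ⬝ᵥ u = 1 := by simpa using inner_eq i i
  have hvv : v ⬝ᵥ v = 1 := by simpa using inner_eq j j
  have huv : u ⬝ᵥ v = 0 := by simpa [hij] using inner_eq i j
  have hvu : v ⬝ᵥ u = 0 := by rw [dotProduct_comm, huv]
  obtain ⟨a, b, hab, hs⟩ : ∃ a b : ℝ, 0 < a ^ 2 + b ^ 2 ∧ a * (s ⬝ᵥ u) + b * (s ⬝ᵥ v) = 0 := by
    by_cases h : s ⬝ᵥ u = 0
    · exact ⟨1, 0, by norm_num, by simp [h]⟩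
    · exact ⟨s ⬝ᵥ v, -(s ⬝ᵥ u), by
        nlinarith [sq_nonneg (s ⬝ᵥ v), pow_pos (abs_pos.mpr h) 2, sq_abs (s ⬝ᵥ u)], by ring⟩
  have hSu := hS.mulVec_eigenvectorBasis i
  have hSv := hS.mulVec_eigenvectorBasis j
  rw [← hu] at hSu
  rw [← hv] at hSv
  have hform := dotProduct_diagonal_sub_vecMulVec_mulVec d s (a • u + b • v) c
  have hsw : s ⬝ᵥ (a • u + b • v) = 0 := by simpa [dotProduct_add] using hs
  have hww : (a • u + b • v) ⬝ᵥ (a • u + b • v) = a ^ 2 + b ^ 2 := by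
    simp only [dotProduct_add, add_dotProduct, dotProduct_smul, smul_dotProduct, huu, hvv, huv,
      hvu, smul_eq_mul]
    ring
  rw [hsw, mulVec_add, mulVec_smul, mulVec_smul, hSu, hSv] at hform
  simp only [dotProduct_add, add_dotProduct, dotProduct_smul, smul_dotProduct, huu, hvv, huv,
    hvu, smul_eq_mul] at hform
  have hpos : 0 < ∑ m, d m * (a • u + b • v) m ^ 2 := by
    refine Finset.sum_pos' (fun m _ => mul_nonneg (hd m).le (sq_nonneg _)) ?_
    by_contra! h
    have hz : a • u + b • v = 0 := by
      ext m
      have h0 := h m (Finset.mem_univ m)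
      by_contra hm
      exact absurd (mul_pos (hd m) (pow_pos (abs_pos.mpr hm) 2)) (by simpa using h0)
    rw [hz, zero_dotProduct] at hww
    exact hab.ne hww
  nlinarith [mul_nonneg (sq_nonneg a) (neg_nonneg.mpr hi),
    mul_nonneg (sq_nonneg b) (neg_nonneg.mpr hj)]

theorem exists_eigenvalues_neg {ι : Type*} [Fintype ι] [DecidableEq ι] {d s : ι → ℝ} {c : ℝ}
    (hd : ∀ i, 0 < d i) (hS : (diagonal d - c • vecMulVec s s).IsHermitian)
    (hc : 1 < c * ∑ i, s i ^ 2 / d i) : ∃ i, hS.eigenvalues i < 0 := by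
  by_contra! h
  have hform := dotProduct_diagonal_sub_vecMulVec_mulVec d s (fun i => s i / d i) c
  have hnonneg := (hS.posSemidef_iff_eigenvalues_nonneg.mpr h).dotProduct_mulVec_nonneg
    (fun i => s i / d i)
  rw [star_trivial, hform] at hnonneg
  have h1 : ∑ i, d i * (s i / d i) ^ 2 = ∑ i, s i ^ 2 / d i :=
    Finset.sum_congr rfl fun i _ => by
      have := (hd i).ne'
      field_simp
  have h2 : s ⬝ᵥ (fun i => s i / d i) = ∑ i, s i ^ 2 / d i :=
    Finset.sum_congr rfl fun i _ => by ring
  have h3 : 0 ≤ ∑ i, s i ^ 2 / d i :=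
    Finset.sum_nonneg fun i _ => div_nonneg (sq_nonneg _) (hd i).le
  rw [h1, h2] at hnonneg
  have h4 : ∑ i, s i ^ 2 / d i ≠ 0 := fun h0 => by
    rw [h0] at hc
    norm_num at hc
  nlinarith [mul_pos (h3.lt_of_ne' h4) (sub_pos.mpr hc)]

theorem one_lt_mul_sum_div {n k : ℕ} (hn : 1 ≤ n) (hk : 1 ≤ k) {α : Fin k → ℕ}
    (hα : ∀ i, 0 < α i) (hl2 : 2 ≤ ∑ i, α i) (hexc : ¬(n = 1 ∧ k = 1 ∧ ∑ i, α i = 2)) :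
    1 < ((n : ℝ) + 1 / 2) * ∑ i, (α i : ℝ) / (1 + n + α i / 2) := by
  have hn' : (1 : ℝ) ≤ n := by exact_mod_cast hn
  obtain rfl | hk2 := hk.eq_or_lt
  · simp only [Finset.univ_unique, Finset.sum_singleton, true_and] at hl2 hexc ⊢
    set m := α default
    have hnat : 2 + n < n * m + 1 := by
      rcases hn.eq_or_lt with rfl | h
      · have : m ≠ 2 := by simpa using hexc
        omega
      · nlinarith
    have hreal : (2 + n : ℝ) < n * m + 1 := by exact_mod_cast hnat
    rw [← mul_div_assoc, one_lt_div (by positivity)]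
    linarith
  · have hterm (i : Fin k) : 1 / (n + 3 / 2) ≤ (α i : ℝ) / (1 + n + α i / 2) := by
      have : (1 : ℝ) ≤ α i := by exact_mod_cast hα i
      rw [div_le_div_iff₀ (by positivity) (by positivity)]
      nlinarith
    have hsum := Finset.card_nsmul_le_sum Finset.univ _ _ fun i _ => hterm i
    rw [Finset.card_univ, Fintype.card_fin, nsmul_eq_mul] at hsum
    have hk' : (2 : ℝ) ≤ k := by exact_mod_cast hk2
    calc (1 : ℝ) < (n + 1 / 2) * (2 * (1 / (n + 3 / 2))) := by
          rw [mul_one_div, ← mul_div_assoc, one_lt_div (by positivity)]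
          linarith
      _ ≤ (n + 1 / 2) * (k * (1 / (n + 3 / 2))) := by gcongr
      _ ≤ _ := by gcongr

/-- every eigenvalue of the reduced matrix `A` is real and nonzero, and
`A` has exactly one negative and `k - 1` positive eigenvalues, counted with
multiplicity: its characteristic polynomial has `k` real roots with multiplicity,
none of which is zero, exactly one of which is negative. -/
theorem signature_of_A
    (n k : ℕ) (hn : 1 ≤ n) (hk : 1 ≤ k)
    (α : Fin k → ℕ) (hα : ∀ i, 0 < α i)
    (l : ℕ) (hl : l = ∑ i, α i) (hl2 : 2 ≤ l)
    (hexc : ¬(n = 1 ∧ k = 1 ∧ l = 2))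
    (A : Matrix (Fin k) (Fin k) ℝ)
    (hA : ∀ i j, A i j =
      if i = j then 1 - ((α i : ℝ) - 1) * n else -((n : ℝ) + 1 / 2) * α j) :
    Multiset.card A.charpoly.roots = k ∧
    (0 : ℝ) ∉ A.charpoly.roots ∧
    Multiset.card (A.charpoly.roots.filter fun x => x < 0) = 1 ∧
    Multiset.card (A.charpoly.roots.filter fun x => 0 < x) = k - 1 := by
  subst hl
  set s : Fin k → ℝ := fun i => √(α i)
  set d : Fin k → ℝ := fun i => 1 + n + α i / 2
  set c : ℝ := n + 1 / 2
  have hd (i : Fin k) : 0 < d i := by positivity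
  have hs (i : Fin k) : 0 < s i := Real.sqrt_pos.mpr (by exact_mod_cast hα i)
  have hss (i : Fin k) : s i ^ 2 = α i := Real.sq_sqrt (Nat.cast_nonneg _)
  have hS := isHermitian_diagonal_sub_vecMulVec d s c
  have hunit : IsUnit (diagonal s) := by
    rw [isUnit_diagonal, Pi.isUnit_iff]
    exact fun i => (hs i).ne'.isUnit
  have hsim : diagonal s * A = (diagonal d - c • vecMulVec s s) * diagonal s := by
    ext i j
    rw [diagonal_mul, mul_diagonal, hA]
    by_cases h : i = j
    · subst h
      simp only [if_true, Matrix.sub_apply, diagonal_apply_eq, Matrix.smul_apply,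
        vecMulVec_apply, smul_eq_mul, ← pow_two, hss, d, c]
      ring
    · simp only [if_neg h, Matrix.sub_apply, diagonal_apply_ne _ h, Matrix.smul_apply,
        vecMulVec_apply, smul_eq_mul, ← hss, c]
      ring
  have hchar : A.charpoly = (diagonal d - c • vecMulVec s s).charpoly := by
    obtain ⟨P, hP⟩ := hunit
    rw [← hP] at hsim
    rw [← Matrix.charpoly_units_conj P A, hsim]
    simp
  have hroots : A.charpoly.roots = Finset.univ.val.map hS.eigenvalues := by
    rw [hchar, hS.roots_charpoly_eq_eigenvalues]
    rfl
  obtain ⟨i, hi⟩ := exists_eigenvalues_neg hd hS (by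
    simp only [hss]
    exact one_lt_mul_sum_div hn hk hα hl2 hexc)
  have hpos {j : Fin k} (hj : j ≠ i) : 0 < hS.eigenvalues j := eigenvalues_pos_of_ne hd hS hj hi.le
  have hneg_iff (j : Fin k) : hS.eigenvalues j < 0 ↔ j = i :=
    ⟨fun h => by_contra fun hj => (hpos hj).not_gt h, fun h => h ▸ hi⟩
  have hpos_iff (j : Fin k) : 0 < hS.eigenvalues j ↔ j ≠ i :=
    ⟨fun h hj => (hj ▸ h).not_gt hi, hpos⟩
  rw [hroots]
  refine ⟨by simp, ?_, ?_, ?_⟩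
  · rw [Multiset.mem_map]
    rintro ⟨j, -, hj⟩
    by_cases h : j = i
    · exact hi.ne (h ▸ hj)
    · exact (hpos h).ne' hj
  · rw [Multiset.filter_map, Multiset.card_map, ← Finset.filter_val, Finset.card_val]
    simp [hneg_iff, Finset.filter_eq']
  · rw [Multiset.filter_map, Multiset.card_map, ← Finset.filter_val, Finset.card_val]
    simp [hpos_iff, Finset.filter_ne']
end

section
/- All diagonal entries of B⁻¹ are positive. -/
open Matrix

/-- The number of indices lying in the same fibre of `b` as `j`, as a real number. -/
noncomputable def fibreSize {ι κ : Type*} [Fintype ι] [DecidableEq κ] (b : ι → κ) (j : ι) : ℝ :=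
  ((Finset.univ.filter fun m => b m = b j).card : ℝ)

lemma one_le_fibreSize {ι κ : Type*} [Fintype ι] [DecidableEq κ] (b : ι → κ) (j : ι) :
    1 ≤ fibreSize b j := by
  unfold fibreSize
  exact_mod_cast Finset.card_pos.mpr ⟨j, by simp⟩

lemma sum_ite_fibre_eq {ι κ : Type*} [Fintype ι] [DecidableEq κ] (b : ι → κ) (m : ι) (f : κ → ℝ) :
    ∑ j, (if b j = b m then f (b j) else 0) = fibreSize b m * f (b m) := by
  rw [← Finset.sum_filter, Finset.sum_congr rfl (g := fun _ => f (b m))]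
  · simp [fibreSize]
  · intro j hj
    rw [(Finset.mem_filter.mp hj).2]

lemma sum_weight_mul_fibre_sum {ι κ : Type*} [Fintype ι] [DecidableEq κ] (b : ι → κ)
    (f : κ → ℝ) (x : ι → ℝ) :
    ∑ j, f (b j) * ∑ m, (if b j = b m then x m else 0) =
      ∑ m, fibreSize b m * f (b m) * x m := by
  simp_rw [Finset.mul_sum]
  rw [Finset.sum_comm]
  refine Finset.sum_congr rfl fun m _ => ?_
  rw [← sum_ite_fibre_eq, Finset.sum_mul]
  refine Finset.sum_congr rfl fun j _ => ?_
  split_ifs <;> simp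

lemma sum_inv_fibreSize_ge {ι κ : Type*} [Fintype ι] [DecidableEq κ] (b : ι → κ) (i : ι)
    {c : ℝ} (hc : 0 < c) :
    fibreSize b i / (c + fibreSize b i) +
      (Fintype.card ι - fibreSize b i) / (c + (Fintype.card ι - fibreSize b i)) ≤
      ∑ j, (c + fibreSize b j)⁻¹ := by
  have hcompl : ((Finset.univ.filter fun m => ¬ b m = b i).card : ℝ) =
      Fintype.card ι - fibreSize b i := by
    have h := Finset.card_filter_add_card_filter_not (s := (Finset.univ : Finset ι))
      (fun m => b m = b i)
    rw [Finset.card_univ] at h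
    rw [eq_sub_iff_add_eq, fibreSize, add_comm]
    exact_mod_cast h
  rw [← Finset.sum_filter_add_sum_filter_not Finset.univ (fun m => b m = b i)]
  refine add_le_add (le_of_eq ?_) ?_
  · rw [Finset.sum_congr rfl (g := fun _ => (c + fibreSize b i)⁻¹)]
    · simp [fibreSize, div_eq_mul_inv]
    · intro j hj
      simp [fibreSize, (Finset.mem_filter.mp hj).2]
  · rw [← hcompl, div_eq_mul_inv, ← nsmul_eq_mul]
    refine Finset.card_nsmul_le_sum _ _ _ fun j hj => ?_
    have hj' := (Finset.mem_filter.mp hj).2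
    have h1 := one_le_fibreSize b j
    have hle : fibreSize b j ≤ ((Finset.univ.filter fun m => ¬ b m = b i).card : ℝ) := by
      unfold fibreSize
      refine Nat.cast_le.mpr (Finset.card_le_card fun m hm => ?_)
      simp only [Finset.mem_filter, Finset.mem_univ, true_and] at hm ⊢
      rwa [hm]
    exact inv_anti₀ (by linarith) (by linarith)

lemma weight_bound {a r : ℕ} (ha : 1 ≤ a) (har : 3 ≤ a + r) {c W : ℝ} (hc : 6 ≤ c)
    (hW : (a : ℝ) / (c + a) + r / (c + r) ≤ W) :
    (c - 1) * c < (c + a - 1) * (c + a) * ((c - 1) * W - 1) := by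
  have mono : ∀ {s t : ℝ}, 0 ≤ s → s ≤ t → s / (c + s) ≤ t / (c + t) := by
    intro s t hs hst
    rw [div_le_div_iff₀ (by linarith) (by linarith)]
    nlinarith
  have ha' : (1 : ℝ) ≤ a := by exact_mod_cast ha
  have key : 3 / (c + 3) ≤ W → 3 ≤ a →
      (c - 1) * c < (c + a - 1) * (c + a) * ((c - 1) * W - 1) := by
    intro h h3
    have h3' : (3 : ℝ) ≤ a := by exact_mod_cast h3
    rw [div_le_iff₀ (by linarith)] at h
    have hD : 2 * c - 6 ≤ (c + 3) * ((c - 1) * W - 1) := by nlinarith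
    have hD0 : 0 < (c - 1) * W - 1 := by
      by_contra! hneg
      nlinarith
    have e1 : (c + 2) * (c + 3) ≤ (c + a - 1) * (c + a) := by nlinarith
    calc (c - 1) * c < (c + 2) * (2 * c - 6) := by nlinarith
      _ ≤ (c + 2) * ((c + 3) * ((c - 1) * W - 1)) :=
        mul_le_mul_of_nonneg_left hD (by linarith)
      _ = (c + 2) * (c + 3) * ((c - 1) * W - 1) := by ring
      _ ≤ _ := mul_le_mul_of_nonneg_right e1 hD0.le
  have key' : 1 / (c + 1) + 2 / (c + 2) ≤ W →
      (c - 1) * c < (c + a - 1) * (c + a) * ((c - 1) * W - 1) := by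
    intro h
    rw [div_add_div _ _ (by linarith) (by linarith), div_le_iff₀ (by nlinarith)] at h
    have hD : 2 * c ^ 2 - 2 * c - 6 ≤ (c + 1) * (c + 2) * ((c - 1) * W - 1) := by
      nlinarith
    have hD0 : 0 < (c - 1) * W - 1 := by
      refine pos_of_mul_pos_right (lt_of_lt_of_le ?_ hD) (by nlinarith)
      nlinarith
    have e1 : c * (c + 1) ≤ (c + a - 1) * (c + a) := by nlinarith
    refine lt_of_lt_of_le ?_ (mul_le_mul_of_nonneg_right e1 hD0.le)
    have e2 : (c - 1) * (c + 2) < (c + 2) * ((c + 1) * ((c - 1) * W - 1)) := by nlinarith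
    have e3 : c - 1 < (c + 1) * ((c - 1) * W - 1) := by
      rw [mul_comm (c - 1)] at e2
      exact lt_of_mul_lt_mul_left e2 (by linarith)
    nlinarith
  have hr0 : (0 : ℝ) ≤ r := Nat.cast_nonneg r
  rcases Nat.lt_or_ge a 3 with h | h
  · apply key'
    interval_cases a
    · have hr : (2 : ℝ) ≤ r := by exact_mod_cast (by omega : 2 ≤ r)
      have := mono (by norm_num) hr
      push_cast at hW
      linarith
    · have hr : (1 : ℝ) ≤ r := by exact_mod_cast (by omega : 1 ≤ r)
      have := mono (by norm_num) hr
      push_cast at hW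
      linarith
  · refine key ?_ h
    have h3 : (3 : ℝ) ≤ a := by exact_mod_cast h
    have := mono (by norm_num) h3
    have : 0 ≤ (r : ℝ) / (c + r) := by positivity
    linarith

/-- The `i`-th coordinate of a solution of `(c • 1 - (c - 1) • J + E) x = 2 • eᵢ` is positive, where
`J` is the all-ones matrix and `E` the indicator matrix of the fibres of `b`. -/
lemma solution_apply_pos {ι κ : Type*} [Fintype ι] [DecidableEq ι] [DecidableEq κ] (b : ι → κ)
    (hcard : 3 ≤ Fintype.card ι) {c : ℝ} (hc : 6 ≤ c) (i : ι) (x : ι → ℝ)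
    (hx : ∀ j, c * x j - (c - 1) * ∑ m, x m + ∑ m, (if b j = b m then x m else 0) =
      if j = i then 2 else 0) :
    0 < x i := by
  set S := ∑ m, x m with hS
  set s := ∑ m, (if b i = b m then x m else 0) with hs
  set a := fibreSize b i with ha
  set W := ∑ j, (c + fibreSize b j)⁻¹ with hW
  have ha1 : 1 ≤ a := one_le_fibreSize b i
  have weighted : ∀ f : κ → ℝ,
      ∑ m, (c + fibreSize b m) * f (b m) * x m - (c - 1) * S * ∑ j, f (b j) = 2 * f (b i) := by
    intro f
    have h := Finset.sum_congr rfl fun j (_ : j ∈ Finset.univ) => congrArg (f (b j) * ·) (hx j)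
    simp only [mul_add, mul_sub, Finset.sum_add_distrib, Finset.sum_sub_distrib,
      sum_weight_mul_fibre_sum, mul_ite, mul_zero, Finset.sum_ite_eq', Finset.mem_univ,
      if_true] at h
    simp only [add_mul, Finset.sum_add_distrib]
    rw [← Finset.sum_mul] at h
    have e : ∑ m, c * f (b m) * x m = ∑ m, f (b m) * (c * x m) :=
      Finset.sum_congr rfl fun _ _ => by ring
    rw [e]
    linarith
  have total : S - (c - 1) * S * W = 2 * (c + a)⁻¹ := by
    have h := weighted fun y => (c + ((Finset.univ.filter fun m => b m = y).card : ℝ))⁻¹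
    change ∑ m, (c + fibreSize b m) * (c + fibreSize b m)⁻¹ * x m - (c - 1) * S * W =
      2 * (c + a)⁻¹ at h
    rw [← h, hS]
    congr 1
    refine Finset.sum_congr rfl fun m _ => ?_
    have := one_le_fibreSize b m
    rw [mul_inv_cancel₀ (by linarith), one_mul]
  have block : (c + a) * s - (c - 1) * S * a = 2 := by
    have h := weighted fun y => if b i = y then 1 else 0
    have e1 : ∑ m, (c + fibreSize b m) * (if b i = b m then 1 else 0) * x m = (c + a) * s := by
      rw [hs, Finset.mul_sum]
      refine Finset.sum_congr rfl fun m _ => ?_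
      split_ifs with hm
      · simp [ha, fibreSize, hm]
      · simp
    have e2 : ∑ j, (if b i = b j then (1 : ℝ) else 0) = a := by
      simp [ha, fibreSize, eq_comm]
    rw [e1, e2] at h
    simpa using h
  have diag : c * x i - (c - 1) * S + s = 2 := by simpa using hx i
  have bound : (c - 1) * c < (c + a - 1) * (c + a) * ((c - 1) * W - 1) := by
    have hle : (Finset.univ.filter fun m => b m = b i).card ≤ Fintype.card ι :=
      Finset.card_le_univ _
    have hge := sum_inv_fibreSize_ge b i (show 0 < c by linarith)
    refine weight_bound (r := Fintype.card ι - (Finset.univ.filter fun m => b m = b i).card)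
      (Finset.card_pos.mpr ⟨i, by simp⟩) (by omega) hc ?_
    rw [Nat.cast_sub hle]
    exact hge
  have hca : 0 < c + a := by linarith
  have hD : 0 < (c - 1) * W - 1 := by
    refine pos_of_mul_pos_right (lt_trans ?_ bound) ?_
    · nlinarith
    · nlinarith
  have total' : S * ((c - 1) * W - 1) * (c + a) = -2 := by
    have := congrArg (· * (c + a)) total
    simp only [mul_assoc, inv_mul_cancel₀ hca.ne'] at this
    linarith
  have coord : c * (c + a) * x i = 2 * (c + a - 1) + (c - 1) * c * S := by
    linear_combination (c + a) * diag - block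
  have main : ((c - 1) * W - 1) * (c + a) * (c * (c + a)) * x i =
      2 * ((c + a - 1) * (c + a) * ((c - 1) * W - 1) - (c - 1) * c) := by
    linear_combination ((c - 1) * W - 1) * (c + a) * coord + (c - 1) * c * total'
  have hc0 : 0 < c := by linarith
  refine pos_of_mul_pos_right (a := ((c - 1) * W - 1) * (c + a) * (c * (c + a))) ?_ (by positivity)
  rw [main]
  linarith

/-- all diagonal entries of `B⁻¹` are positive (with `n ≥ 2`, `l ≥ 3`,
`B` the invertible block matrix). -/
theorem inv_B_diag_pos
    (n k : ℕ) (hn : 2 ≤ n) (hk : 1 ≤ k)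
    (α : Fin k → ℕ) (hα : ∀ i, 0 < α i)
    (l : ℕ) (hl : l = ∑ i, α i) (hl3 : 3 ≤ l)
    (blk : Fin l → Fin k) (hmono : Monotone blk)
    (hcard : ∀ j, (Finset.univ.filter fun i => blk i = j).card = α j)
    (B : Matrix (Fin l) (Fin l) ℝ)
    (hB : ∀ i j, B i j =
      if i = j then 1 else if blk i = blk j then -(n : ℝ) else -((n : ℝ) + 1 / 2))
    (hunit : IsUnit B.det) :
    ∀ i, 0 < B⁻¹ i i := by
  intro i
  have hn' : (2 : ℝ) ≤ n := by exact_mod_cast hn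
  refine solution_apply_pos blk (by simpa using hl3) (c := 2 * n + 2) (by linarith) i
    (fun j => B⁻¹ j i) fun j => ?_
  have h := congrFun (congrFun (Matrix.mul_nonsing_inv B hunit) j) i
  rw [Matrix.mul_apply, Matrix.one_apply] at h
  have hrow : ∀ m, 2 * (B j m * B⁻¹ m i) = (if j = m then (2 * (n : ℝ) + 2) * B⁻¹ m i else 0) -
      (2 * n + 2 - 1) * B⁻¹ m i + (if blk j = blk m then B⁻¹ m i else 0) := by
    intro m
    rw [hB]
    by_cases hjm : j = m
    · subst hjm
      simp
      ring
    · by_cases hb : blk j = blk m <;> simp [hjm, hb] <;> ring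
  have h2 := congrArg (2 * ·) h
  simp only [Finset.mul_sum, hrow, Finset.sum_add_distrib, Finset.sum_sub_distrib,
    Finset.sum_ite_eq, Finset.mem_univ, if_true] at h2
  rw [Finset.mul_sum, h2]
  split_ifs <;> simp
end

section
/- Each M_j is an involution (M_j² = I_l) and satisfies M_jᵀ · B⁻¹ · M_j = B⁻¹; equivalently, the linear map M_j preserves the symmetric bilinear form (x, y) ↦ −xᵀ B⁻¹ y on ℝ^l. -/
open Matrix

namespace Matrix

variable {n R : Type*} [Fintype n] [DecidableEq n] [CommRing R]

theorem single_mul_mul_single_of_apply_eq_one {B : Matrix n n R} {j : n} (h : B j j = 1) :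
    single j j 1 * B * single j j 1 = single j j 1 := by
  simp [h]

theorem mul_self_one_sub_two_smul_mul {B E : Matrix n n R} (h : E * B * E = E) :
    (1 - (2 : R) • (B * E)) * (1 - (2 : R) • (B * E)) = 1 := by
  have h' : B * E * (B * E) = B * E := by
    rw [Matrix.mul_assoc, ← Matrix.mul_assoc E, h]
  simp only [sub_mul, mul_sub, one_mul, mul_one, smul_mul_assoc, mul_smul_comm, h']
  module

theorem transpose_mul_inv_mul_one_sub_two_smul_mul {B E : Matrix n n R} (hB : B.IsSymm)
    (hE : E.IsSymm) (hdet : IsUnit B.det) (h : E * B * E = E) :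
    (1 - (2 : R) • (B * E))ᵀ * B⁻¹ * (1 - (2 : R) • (B * E)) = B⁻¹ := by
  have hleft : (1 - (2 : R) • (B * E))ᵀ * B⁻¹ = B⁻¹ - (2 : R) • E := by
    rw [transpose_sub, transpose_one, transpose_smul, transpose_mul, hB.eq, hE.eq, sub_mul,
      one_mul, smul_mul_assoc, mul_nonsing_inv_cancel_right B E hdet]
  rw [hleft]
  simp only [sub_mul, mul_sub, mul_one, smul_mul_assoc, mul_smul_comm,
    nonsing_inv_mul_cancel_left B E hdet, ← Matrix.mul_assoc E B E, h]
  module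

end Matrix

/-- each `M j` (the identity except in column `j`, where the diagonal
entry is `-1` and the off-diagonal entries are `-2·B i j`) is an involution and
preserves the symmetric bilinear form `(x, y) ↦ -xᵀ B⁻¹ y`, i.e.
`M jᵀ · B⁻¹ · M j = B⁻¹`. -/
theorem involutions_preserve_form
    (l : ℕ) (hl : 1 ≤ l)
    (B : Matrix (Fin l) (Fin l) ℝ) (hsymm : B.IsSymm) (hunit : IsUnit B.det)
    (hdiag : ∀ j, B j j = 1)
    (M : Fin l → Matrix (Fin l) (Fin l) ℝ)
    (hM : ∀ j i i', M j i i' =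
      if i' = j then (if i = j then -1 else -2 * B i j) else (if i = i' then 1 else 0)) :
    ∀ j, M j * M j = 1 ∧ (M j)ᵀ * B⁻¹ * M j = B⁻¹ := by
  intro j
  have hE := single_mul_mul_single_of_apply_eq_one (hdiag j)
  have hMj : M j = 1 - (2 : ℝ) • (B * single j j 1) := by
    ext i i'
    rw [hM]
    rcases eq_or_ne i' j with rfl | hi'
    · rcases eq_or_ne i i' with rfl | hi
      · simp [hdiag]
        norm_num
      · simp [hi]
    · simp [hi', one_apply]
  rw [hMj]
  exact ⟨mul_self_one_sub_two_smul_mul hE,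
    transpose_mul_inv_mul_one_sub_two_smul_mul hsymm (transpose_single j j 1) hunit hE⟩
end

section
/- If v ∈ V is i-negative and j ≠ i, then ι_j(v) is j-negative. -/
open Matrix

/-- A vector `v` is `i`-negative if `⟨α i, v⟩ ≤ 0`, `⟨α j, v⟩ ≥ 0` for all `j ≠ i`,
and `⟨α i, v + ι j v⟩ ≥ 0` for all `j ≠ i`. -/
def IsINegative {V : Type*} [AddCommGroup V] [Module ℝ V]
    (Φ : V →ₗ[ℝ] V →ₗ[ℝ] ℝ) {l : ℕ} (α : Fin l → V) (ι : Fin l → V → V)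
    (i : Fin l) (v : V) : Prop :=
  Φ (α i) v ≤ 0 ∧ (∀ j, j ≠ i → 0 ≤ Φ (α j) v) ∧ ∀ j, j ≠ i → 0 ≤ Φ (α i) (v + ι j v)

/-- if `v` is `i`-negative and `j ≠ i`, then `ι j v` is `j`-negative.
Here `⟨·,·⟩ = Φ` is a symmetric bilinear form with `⟨α j, α j⟩ = -1` and
`⟨α j, α k⟩ = b j k / 2 ≥ 1` for `j ≠ k`, and `ι j v = v + 2⟨v, α j⟩ α j`. -/
theorem iNegative_reflect {V : Type*} [AddCommGroup V] [Module ℝ V]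
    (Φ : V →ₗ[ℝ] V →ₗ[ℝ] ℝ) (hsymm : ∀ x y, Φ x y = Φ y x)
    (l : ℕ) (hl : 2 ≤ l) (α : Fin l → V)
    (b : Fin l → Fin l → ℝ)
    (hbsymm : ∀ j k, b j k = b k j) (hb : ∀ j k, j ≠ k → 2 ≤ b j k)
    (hαα : ∀ j, Φ (α j) (α j) = -1)
    (hαjk : ∀ j k, j ≠ k → Φ (α j) (α k) = b j k / 2)
    (ι : Fin l → V → V) (hι : ∀ j v, ι j v = v + (2 * Φ v (α j)) • α j) :
    ∀ (i j : Fin l) (v : V), j ≠ i →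
      IsINegative Φ α ι i v → IsINegative Φ α ι j (ι j v) := by
  intro i j v hji hv
  obtain ⟨hi, hpos, hadd⟩ := hv
  have hj := hpos j hji
  have pair_reflect : ∀ k m u, k ≠ m →
      Φ (α k) (ι m u) = Φ (α k) u + b k m * Φ (α m) u := by
    intro k m u hkm
    rw [hι, map_add, map_smul, hαjk k m hkm, hsymm u (α m), smul_eq_mul]
    ring
  have pair_reflect_self : ∀ m u, Φ (α m) (ι m u) = -Φ (α m) u := by
    intro m u
    rw [hι, map_add, map_smul, hαα, hsymm u (α m), smul_eq_mul]
    ring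
  have lower : ∀ k, k ≠ j → b k j / 2 * Φ (α j) v ≤ Φ (α k) (ι j v) := by
    intro k hkj
    rw [pair_reflect k j v hkj]
    have hbv : 0 ≤ b k j * Φ (α j) v := mul_nonneg (by linarith [hb k j hkj]) hj
    by_cases hki : k = i
    · subst hki
      have h := hadd j hji
      rw [map_add, pair_reflect k j v hkj] at h
      linarith
    · linarith [hpos k hki]
  refine ⟨?_, fun k hkj => ?_, fun k hkj => ?_⟩
  · rw [pair_reflect_self]
    linarith
  · exact le_trans (mul_nonneg (by linarith [hb k j hkj]) hj) (lower k hkj)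
  · have hbk := hb k j hkj
    rw [map_add, pair_reflect j k _ hkj.symm, pair_reflect_self, hbsymm j k]
    have h := mul_le_mul_of_nonneg_left (lower k hkj) (by linarith : 0 ≤ b k j)
    have hsq : 0 ≤ (b k j * b k j - 4) * Φ (α j) v := mul_nonneg (by nlinarith) hj
    linarith
end

section
/- The set F̄¹ := {v ∈ F̄ : ⟨v, v⟩ = 1} is a compact subset of ℝ^l. -/
open Matrix

/-- The bilinear form `⟨x, y⟩ = -xᵀ B⁻¹ y` on `ℝ^l`. -/
noncomputable def bilB {l : ℕ} (B : Matrix (Fin l) (Fin l) ℝ) (x y : Fin l → ℝ) : ℝ :=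
  -(x ⬝ᵥ B⁻¹.mulVec y)

/-- `α j := -B·e j`, the `j`-th column of `-B`. -/
def alphaVec {l : ℕ} (B : Matrix (Fin l) (Fin l) ℝ) (j : Fin l) : Fin l → ℝ :=
  fun p => -B p j

/-- The fundamental cone `F̄ = {v : ⟨v, eᵢ⟩ ≥ 0 ∀i, ⟨v, αⱼ⟩ ≥ 0 ∀j}`. -/
noncomputable def FbarSet {l : ℕ} (B : Matrix (Fin l) (Fin l) ℝ) : Set (Fin l → ℝ) :=
  {v | (∀ i, 0 ≤ bilB B v (Pi.single i 1)) ∧ ∀ j, 0 ≤ bilB B v (alphaVec B j)}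

/-- Moving `B⁻¹` onto the left argument of the form. -/
theorem bilB_eq_dotProduct {l : ℕ} (B : Matrix (Fin l) (Fin l) ℝ) (x y : Fin l → ℝ) :
    bilB B x y = -(x ᵥ* B⁻¹) ⬝ᵥ y := by
  rw [bilB, dotProduct_mulVec, neg_dotProduct]

theorem bilB_single {l : ℕ} (B : Matrix (Fin l) (Fin l) ℝ) (x : Fin l → ℝ) (i : Fin l) :
    bilB B x (Pi.single i 1) = (-(x ᵥ* B⁻¹)) i := by
  rw [bilB_eq_dotProduct, dotProduct_single_one]

theorem bilB_alphaVec {l : ℕ} {B : Matrix (Fin l) (Fin l) ℝ} (hB : IsUnit B.det)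
    (x : Fin l → ℝ) (j : Fin l) : bilB B x (alphaVec B j) = x j := by
  have h : alphaVec B j = -(B *ᵥ Pi.single j 1) := by
    ext p
    simp [alphaVec]
  rw [bilB, h, mulVec_neg, mulVec_mulVec, nonsing_inv_mul B hB, one_mulVec, dotProduct_neg,
    neg_neg, dotProduct_single_one]

theorem continuous_bilB {l : ℕ} (B : Matrix (Fin l) (Fin l) ℝ) :
    Continuous fun p : (Fin l → ℝ) × (Fin l → ℝ) => bilB B p.1 p.2 := by
  unfold bilB
  fun_prop

theorem isClosed_FbarSet {l : ℕ} (B : Matrix (Fin l) (Fin l) ℝ) : IsClosed (FbarSet B) := by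
  have h (y : Fin l → ℝ) : IsClosed {v | 0 ≤ bilB B v y} :=
    isClosed_le continuous_const ((continuous_bilB B).comp (by fun_prop : Continuous (·, y)))
  simp only [FbarSet, Set.ofPred_and, Set.ofPred_forall]
  exact (isClosed_iInter fun _ => h _).inter (isClosed_iInter fun _ => h _)

/-- A nonnegative vector `w` of total mass `S`, paired to `1` with a nonnegative vector `v` that
satisfies `a S - (a + 1) wᵢ ≤ vᵢ ≤ b S - (b + 1) wᵢ` with `a ≥ 2`, has `S² ≤ 2 (b + 1)`. -/
theorem sq_sum_le_of_dotProduct_eq_one {ι : Type*} [Fintype ι] [Nonempty ι] {a b : ℝ}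
    (ha : 2 ≤ a) (hb : 0 ≤ b) {v w : ι → ℝ} (hv : 0 ≤ v) (hw : 0 ≤ w)
    (hlow : ∀ i, a * ∑ j, w j - (a + 1) * w i ≤ v i)
    (hupp : ∀ i, v i ≤ b * ∑ j, w j - (b + 1) * w i)
    (hone : w ⬝ᵥ v = 1) : (∑ j, w j) ^ 2 ≤ 2 * (b + 1) := by
  classical
  obtain ⟨i, -, hi⟩ := Finset.exists_max_image Finset.univ w Finset.univ_nonempty
  set S := ∑ j, w j
  have hS : 0 ≤ S := Finset.sum_nonneg fun j _ => hw j
  have hsum : ∑ j ∈ Finset.univ.erase i, w j = S - w i := by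
    exact eq_sub_of_add_eq' (Finset.add_sum_erase _ _ (Finset.mem_univ i))
  have hterm : ∀ j ∈ Finset.univ.erase i, w j * (S / 2) ≤ w j * v j := by
    intro j hj
    refine mul_le_mul_of_nonneg_left ?_ (hw j)
    have h₁ : w j ≤ S - w i :=
      hsum ▸ Finset.single_le_sum (fun p _ => hw p) hj
    have h₂ := hi j (Finset.mem_univ j)
    nlinarith [hlow j]
  have hpair : (S - w i) * (S / 2) ≤ 1 := by
    rw [← hsum, Finset.sum_mul, ← hone]
    exact (Finset.sum_le_sum hterm).trans <| Finset.sum_le_sum_of_subset_of_nonneg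
      (Finset.erase_subset _ _) fun j _ _ => mul_nonneg (hw j) (hv j)
  have hmax : S ≤ (b + 1) * (S - w i) := by
    have h : 0 ≤ v i := hv i
    linarith [hupp i]
  nlinarith [mul_le_mul_of_nonneg_right hmax hS]

/-- the set `F̄¹ = {v ∈ F̄ : ⟨v, v⟩ = 1}` is compact, for the block
matrix `B` with `n ≥ 2`, `l ≥ 2`, `(n, l) ≠ (2, 2)`. -/
theorem Fbar_one_compact
    (n k : ℕ) (hn : 2 ≤ n) (hk : 1 ≤ k)
    (α : Fin k → ℕ) (hα : ∀ i, 0 < α i)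
    (l : ℕ) (hl : l = ∑ i, α i) (hl2 : 2 ≤ l) (hexc : ¬(n = 2 ∧ l = 2))
    (blk : Fin l → Fin k) (hmono : Monotone blk)
    (hcard : ∀ j, (Finset.univ.filter fun i => blk i = j).card = α j)
    (B : Matrix (Fin l) (Fin l) ℝ)
    (hB : ∀ i j, B i j =
      if i = j then 1 else if blk i = blk j then -(n : ℝ) else -((n : ℝ) + 1 / 2))
    (hunit : IsUnit B.det) :
    IsCompact {v : Fin l → ℝ | v ∈ FbarSet B ∧ bilB B v v = 1} := by
  have : Nonempty (Fin l) := ⟨⟨0, by lia⟩⟩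
  have hn' : (2 : ℝ) ≤ n := by exact_mod_cast hn
  have hclosed : IsClosed {v : Fin l → ℝ | v ∈ FbarSet B ∧ bilB B v v = 1} :=
    (isClosed_FbarSet B).inter <| isClosed_eq
      ((continuous_bilB B).comp (by fun_prop : Continuous fun v => (v, v))) continuous_const
  refine IsCompact.of_isClosed_subset
    (isCompact_Icc (a := 0) (b := fun _ : Fin l => ((n : ℝ) + 1 / 2) * (2 * n + 3))) hclosed ?_
  rintro v ⟨⟨hw, hv⟩, hone⟩
  simp only [bilB_single, bilB_alphaVec hunit] at hw hv
  rw [bilB_eq_dotProduct] at hone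
  obtain ⟨w, hwdef⟩ : ∃ w, w = -(v ᵥ* B⁻¹) := ⟨_, rfl⟩
  rw [← hwdef] at hw hone
  have hvw (i : Fin l) : v i = ∑ j, w j * -B j i := by
    have h : v = -(w ᵥ* B) := by
      rw [hwdef, neg_vecMul, neg_neg, vecMul_vecMul, nonsing_inv_mul B hunit, vecMul_one]
    simpa [vecMul, dotProduct] using congrFun h i
  have hexpand (c : ℝ) (i : Fin l) : c * ∑ j, w j - (c + 1) * w i =
      ∑ j, w j * (c - if j = i then c + 1 else 0) := by
    simp [mul_sub, Finset.sum_sub_distrib, Finset.mul_sum, mul_comm]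
  have hlow (i : Fin l) : n * ∑ j, w j - (n + 1) * w i ≤ v i := by
    rw [hvw, hexpand]
    refine Finset.sum_le_sum fun j _ => mul_le_mul_of_nonneg_left ?_ (hw j)
    rw [hB]
    split_ifs <;> linarith
  have hupp (i : Fin l) :
      v i ≤ (n + 1 / 2) * ∑ j, w j - (n + 1 / 2 + 1) * w i := by
    rw [hvw, hexpand]
    refine Finset.sum_le_sum fun j _ => mul_le_mul_of_nonneg_left ?_ (hw j)
    rw [hB]
    split_ifs <;> linarith
  have hS := sq_sum_le_of_dotProduct_eq_one hn' (by positivity) hv hw hlow hupp hone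
  have hS' : ∑ j, w j ≤ 2 * n + 3 := by nlinarith
  refine ⟨hv, fun i => (hupp i).trans ?_⟩
  have h₁ := mul_le_mul_of_nonneg_left hS' (by positivity : (0 : ℝ) ≤ n + 1 / 2)
  have h₂ := mul_nonneg (by positivity : (0 : ℝ) ≤ n + 1 / 2 + 1) (hw i)
  linarith
end

section
/- A nonzero vector v ∈ F̄ spans an extremal ray of F̄ (i.e., whenever u, w ∈ F̄ satisfy u + w = v, both u and w are nonnegative multiples of v) if and only if v is a positive scalar multiple of ω_{îj} := (b_{ij}/2)·α_i + α_j for some pair i ≠ j in {1, …, l}, where b_{ij} := −2B_{ij}. -/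
open Matrix

/-- `ω_{îj} := (b i j / 2) • α i + α j`, where `b i j = -2 B i j`. -/
noncomputable def omegaVec {l : ℕ} (B : Matrix (Fin l) (Fin l) ℝ) (i j : Fin l) :
    Fin l → ℝ :=
  ((-2 * B i j) / 2) • alphaVec B i + alphaVec B j

/-- The cone of coefficient vectors `c` for which `∑ j, c j • α j` lies in `F̄`. -/
def coeffCone {l : ℕ} (B : Matrix (Fin l) (Fin l) ℝ) : Set (Fin l → ℝ) :=
  {c | (∀ i, 0 ≤ c i) ∧ ∀ i, (B *ᵥ c) i ≤ 0}

/-- The coefficient vector of `ω_{îj}` in terms of the `α p`. -/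
def omegaCoeff {l : ℕ} (B : Matrix (Fin l) (Fin l) ℝ) (i j : Fin l) : Fin l → ℝ :=
  Pi.single j 1 - B i j • Pi.single i 1

section

variable {l : ℕ} {B : Matrix (Fin l) (Fin l) ℝ}

lemma bilB_neg_mulVec (hsymm : B.IsSymm) (hunit : IsUnit B.det) (c y : Fin l → ℝ) :
    bilB B (-(B *ᵥ c)) y = c ⬝ᵥ y := by
  have h : B *ᵥ c = c ᵥ* B := by rw [← mulVec_transpose, hsymm.eq]
  rw [bilB, neg_dotProduct, neg_neg, dotProduct_mulVec, h, vecMul_vecMul,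
    mul_nonsing_inv _ hunit, vecMul_one]

lemma dotProduct_alphaVec (hsymm : B.IsSymm) (c : Fin l → ℝ) (j : Fin l) :
    c ⬝ᵥ alphaVec B j = -(B *ᵥ c) j := by
  simp only [dotProduct, alphaVec, mulVec, mul_neg, Finset.sum_neg_distrib]
  congr 1
  exact Finset.sum_congr rfl fun p _ => by rw [hsymm.apply, mul_comm]

lemma neg_mulVec_mem_FbarSet (hsymm : B.IsSymm) (hunit : IsUnit B.det) (c : Fin l → ℝ) :
    -(B *ᵥ c) ∈ FbarSet B ↔ c ∈ coeffCone B := by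
  simp only [FbarSet, coeffCone, Set.mem_ofPred_eq, bilB_neg_mulVec hsymm hunit,
    dotProduct_alphaVec hsymm, dotProduct_single, mul_one, neg_nonneg]

lemma exists_eq_neg_mulVec (hunit : IsUnit B.det) (v : Fin l → ℝ) :
    ∃ c, v = -(B *ᵥ c) :=
  ⟨-(B⁻¹ *ᵥ v), by
    rw [mulVec_neg, neg_neg, mulVec_mulVec, mul_nonsing_inv _ hunit, one_mulVec]⟩

lemma mulVec_omegaCoeff_apply (i j p : Fin l) :
    (B *ᵥ omegaCoeff B i j) p = B p j - B i j * B p i := by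
  simp [omegaCoeff, mulVec_sub, mulVec_smul]

lemma neg_mulVec_omegaCoeff (i j : Fin l) :
    -(B *ᵥ omegaCoeff B i j) = omegaVec B i j := by
  ext p
  rw [Pi.neg_apply, mulVec_omegaCoeff_apply]
  simp only [omegaVec, alphaVec, Pi.add_apply, Pi.smul_apply, smul_eq_mul]
  ring

lemma omegaCoeff_left {i j : Fin l} (hij : i ≠ j) : omegaCoeff B i j i = -B i j := by
  simp [omegaCoeff, hij]

lemma omegaCoeff_right {i j : Fin l} (hij : i ≠ j) : omegaCoeff B i j j = 1 := by
  simp [omegaCoeff, hij.symm]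

lemma omegaCoeff_of_ne {i j p : Fin l} (hi : p ≠ i) (hj : p ≠ j) :
    omegaCoeff B i j p = 0 := by
  simp [omegaCoeff, hi, hj]

lemma mulVec_omegaCoeff_left (hdiag : ∀ i, B i i = 1) (i j : Fin l) :
    (B *ᵥ omegaCoeff B i j) i = 0 := by
  rw [mulVec_omegaCoeff_apply, hdiag, mul_one, sub_self]

lemma mulVec_apply_eq_add_sum (hdiag : ∀ i, B i i = 1) (c : Fin l → ℝ) (p : Fin l) :
    (B *ᵥ c) p = c p + ∑ q ∈ Finset.univ.erase p, B p q * c q := by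
  rw [mulVec, dotProduct, ← Finset.add_sum_erase _ _ (Finset.mem_univ p), hdiag, one_mul]

lemma exists_pos_forall_mul_le {ι : Type*} [Finite ι] {a b : ι → ℝ}
    (h : ∀ p, 0 < a p ∨ 0 ≤ a p ∧ b p ≤ 0) : ∃ t > 0, ∀ p, t * b p ≤ a p := by
  have hev : ∀ᶠ t : ℝ in nhdsWithin 0 (Set.Ioi 0), ∀ p, t * b p ≤ a p := by
    refine Filter.eventually_all.2 fun p => ?_
    rcases h p with hp | ⟨ha, hb⟩
    · have hlim : Filter.Tendsto (fun t : ℝ => t * b p) (nhdsWithin 0 (Set.Ioi 0)) (nhds 0) := by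
        have hcont : Continuous fun t : ℝ => t * b p := by fun_prop
        simpa using (hcont.tendsto 0).mono_left nhdsWithin_le_nhds
      exact (hlim.eventually_lt_const hp).mono fun _ => le_of_lt
    · filter_upwards [self_mem_nhdsWithin] with t ht
      exact (mul_nonpos_of_nonneg_of_nonpos (le_of_lt ht) hb).trans ha
  obtain ⟨t, ht, ht0⟩ := (hev.and self_mem_nhdsWithin).exists
  exact ⟨t, ht0, ht⟩

/-- Some positive multiple of a generator can be split off from any nonzero element of the cone:
take `i` maximizing `c i`, so that every other row inequality is strict at `c`. -/
lemma exists_sub_smul_omegaCoeff_mem (hdiag : ∀ i, B i i = 1)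
    (hoff : ∀ i j, i ≠ j → B i j < -1) {c : Fin l → ℝ} (hc : c ∈ coeffCone B) (hc0 : c ≠ 0) :
    ∃ i j, i ≠ j ∧ ∃ t > (0 : ℝ), c - t • omegaCoeff B i j ∈ coeffCone B := by
  obtain ⟨hnn, hrow⟩ := hc
  obtain ⟨q, hq⟩ := Function.ne_iff.1 hc0
  have : Nonempty (Fin l) := ⟨q⟩
  obtain ⟨i, hi⟩ := Finite.exists_max c
  have hci : 0 < c i := ((hnn q).lt_of_ne' hq).trans_le (hi q)
  obtain ⟨j, hij, hcj⟩ : ∃ j, i ≠ j ∧ 0 < c j := by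
    by_contra! h
    have := hrow i
    rw [mulVec_apply_eq_add_sum hdiag, Finset.sum_eq_zero] at this
    · linarith
    · intro r hr
      rw [le_antisymm (h r (Finset.ne_of_mem_erase hr).symm) (hnn r), mul_zero]
  have hslack : ∀ p, p ≠ i → (B *ᵥ c) p < 0 := by
    intro p hp
    rw [mulVec_apply_eq_add_sum hdiag]
    have hle : ∑ r ∈ Finset.univ.erase p, B p r * c r ≤ B p i * c i := by
      rw [← Finset.add_sum_erase _ _ (Finset.mem_erase.2 ⟨hp.symm, Finset.mem_univ i⟩)]
      refine add_le_of_nonpos_right (Finset.sum_nonpos fun r hr => ?_)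
      have hr' : p ≠ r := (Finset.ne_of_mem_erase (Finset.mem_of_mem_erase hr)).symm
      exact mul_nonpos_of_nonpos_of_nonneg (by linarith [hoff p r hr']) (hnn r)
    nlinarith [hi p, hoff p i hp]
  obtain ⟨t₁, ht₁, h₁⟩ := exists_pos_forall_mul_le (a := c) (b := omegaCoeff B i j) (by
    intro p
    by_cases hpi : p = i
    · exact .inl (hpi ▸ hci)
    by_cases hpj : p = j
    · exact .inl (hpj ▸ hcj)
    exact .inr ⟨hnn p, (omegaCoeff_of_ne hpi hpj).le⟩)
  obtain ⟨t₂, ht₂, h₂⟩ := exists_pos_forall_mul_le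
    (a := fun p => -(B *ᵥ c) p) (b := fun p => -(B *ᵥ omegaCoeff B i j) p) (by
      intro p
      by_cases hpi : p = i
      · subst hpi
        exact .inr ⟨neg_nonneg.2 (hrow p), by simp [mulVec_omegaCoeff_left hdiag]⟩
      · exact .inl (neg_pos.2 (hslack p hpi)))
  have scale : ∀ {s t a b : ℝ}, 0 < t → t ≤ s → 0 ≤ a → s * b ≤ a → t * b ≤ a := by
    intro s t a b ht hts ha hb
    rcases le_total b 0 with h | h
    · exact (mul_nonpos_of_nonneg_of_nonpos ht.le h).trans ha
    · exact (mul_le_mul_of_nonneg_right hts h).trans hb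
  have ht : 0 < min t₁ t₂ := lt_min ht₁ ht₂
  refine ⟨i, j, hij, min t₁ t₂, ht, fun p => ?_, fun p => ?_⟩
  · exact sub_nonneg.2 (scale ht (min_le_left _ _) (hnn p) (h₁ p))
  · rw [mulVec_sub, mulVec_smul, Pi.sub_apply, Pi.smul_apply, smul_eq_mul]
    linarith [scale ht (min_le_right _ _) (neg_nonneg.2 (hrow p)) (h₂ p)]

lemma omegaCoeff_mem (hdiag : ∀ i, B i i = 1) (hoff : ∀ i j, i ≠ j → B i j < -1)
    {i j : Fin l} (hij : i ≠ j) : omegaCoeff B i j ∈ coeffCone B := by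
  have hm := hoff i j hij
  refine ⟨fun p => ?_, fun p => ?_⟩
  · by_cases hpi : p = i
    · rw [hpi, omegaCoeff_left hij]
      linarith
    by_cases hpj : p = j
    · rw [hpj, omegaCoeff_right hij]
      exact zero_le_one
    exact (omegaCoeff_of_ne hpi hpj).ge
  · by_cases hpi : p = i
    · rw [hpi, mulVec_omegaCoeff_left hdiag]
    rw [mulVec_omegaCoeff_apply]
    have hpi' := hoff p i hpi
    by_cases hpj : p = j
    · rw [hpj] at hpi' ⊢
      rw [hdiag]
      nlinarith
    · have hpj' := hoff p j hpj
      nlinarith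

lemma smul_mem_coeffCone {c : Fin l → ℝ} (hc : c ∈ coeffCone B) {t : ℝ} (ht : 0 ≤ t) :
    t • c ∈ coeffCone B := by
  refine ⟨fun p => mul_nonneg ht (hc.1 p), fun p => ?_⟩
  rw [mulVec_smul]
  exact mul_nonpos_of_nonneg_of_nonpos ht (hc.2 p)

lemma eq_smul_omegaCoeff_of_add_eq (hdiag : ∀ i, B i i = 1) {i j : Fin l} (hij : i ≠ j)
    {a b : Fin l → ℝ} (ha : a ∈ coeffCone B) (hb : b ∈ coeffCone B) {r : ℝ}
    (hab : a + b = r • omegaCoeff B i j) : a = a j • omegaCoeff B i j := by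
  have hzero : ∀ p, p ≠ i → p ≠ j → a p = 0 := by
    intro p hi hj
    have h := congrFun hab p
    rw [Pi.add_apply, Pi.smul_apply, omegaCoeff_of_ne hi hj, smul_zero] at h
    linarith [ha.1 p, hb.1 p]
  have hai : (B *ᵥ a) i = 0 := by
    have h := congrFun (congrArg (B *ᵥ ·) hab) i
    simp only [mulVec_add, mulVec_smul, Pi.add_apply, Pi.smul_apply,
      mulVec_omegaCoeff_left hdiag, smul_zero] at h
    linarith [ha.2 i, hb.2 i]
  rw [mulVec_apply_eq_add_sum hdiag, Finset.sum_eq_single_of_mem j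
    (Finset.mem_erase.2 ⟨hij.symm, Finset.mem_univ j⟩) (fun r hr hrj => by
      rw [hzero r (Finset.ne_of_mem_erase hr) hrj, mul_zero])] at hai
  ext p
  rw [Pi.smul_apply, smul_eq_mul]
  by_cases hpi : p = i
  · rw [hpi, omegaCoeff_left hij]
    linarith
  by_cases hpj : p = j
  · rw [hpj, omegaCoeff_right hij, mul_one]
  rw [omegaCoeff_of_ne hpi hpj, mul_zero, hzero p hpi hpj]

/-- The description of the extremal rays of `F̄` for any symmetric invertible matrix with unit
diagonal and off-diagonal entries smaller than `-1`. -/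
lemma extremal_iff_of_offDiag_lt (hsymm : B.IsSymm) (hunit : IsUnit B.det)
    (hdiag : ∀ i, B i i = 1) (hoff : ∀ i j, i ≠ j → B i j < -1)
    {v : Fin l → ℝ} (hv : v ∈ FbarSet B) (hv0 : v ≠ 0) :
    (∀ u ∈ FbarSet B, ∀ w ∈ FbarSet B, u + w = v →
        (∃ c : ℝ, 0 ≤ c ∧ u = c • v) ∧ (∃ c : ℝ, 0 ≤ c ∧ w = c • v)) ↔
      ∃ i j : Fin l, i ≠ j ∧ ∃ c : ℝ, 0 < c ∧ v = c • omegaVec B i j := by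
  constructor
  · intro hext
    obtain ⟨c, rfl⟩ := exists_eq_neg_mulVec hunit v
    have hc0 : c ≠ 0 := by
      rintro rfl
      simp at hv0
    obtain ⟨i, j, hij, t, ht, hmem⟩ := exists_sub_smul_omegaCoeff_mem hdiag hoff
      ((neg_mulVec_mem_FbarSet hsymm hunit c).1 hv) hc0
    obtain ⟨⟨s, hs, hst⟩, -⟩ := hext _
      ((neg_mulVec_mem_FbarSet hsymm hunit _).2
        (smul_mem_coeffCone (omegaCoeff_mem hdiag hoff hij) ht.le)) _
      ((neg_mulVec_mem_FbarSet hsymm hunit _).2 hmem)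
      (by rw [mulVec_sub]; abel)
    have hst' : t • omegaCoeff B i j = s • c := by
      have hinj := mulVec_injective_iff_isUnit.2 ((isUnit_iff_isUnit_det B).2 hunit)
      refine hinj ?_
      simpa [mulVec_smul] using hst
    have hs0 : s ≠ 0 := by
      rintro rfl
      have h := congrFun hst' j
      simp [omegaCoeff_right hij, ht.ne'] at h
    refine ⟨i, j, hij, t / s, div_pos ht (hs.lt_of_ne' hs0), ?_⟩
    rw [← neg_mulVec_omegaCoeff, smul_neg, ← mulVec_smul, div_eq_inv_mul, mul_smul, hst',
      inv_smul_smul₀ hs0]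
  · rintro ⟨i, j, hij, r, hr, rfl⟩
    have key : ∀ u ∈ FbarSet B, ∀ w ∈ FbarSet B, u + w = r • omegaVec B i j →
        ∃ c : ℝ, 0 ≤ c ∧ u = c • r • omegaVec B i j := by
      intro u hu w hw huw
      obtain ⟨a, rfl⟩ := exists_eq_neg_mulVec hunit u
      obtain ⟨b, rfl⟩ := exists_eq_neg_mulVec hunit w
      rw [neg_mulVec_mem_FbarSet hsymm hunit] at hu hw
      have hab : a + b = r • omegaCoeff B i j := by
        refine mulVec_injective_iff_isUnit.2 ((isUnit_iff_isUnit_det B).2 hunit) ?_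
        rw [← neg_mulVec_omegaCoeff, smul_neg, ← neg_add, neg_inj] at huw
        simpa [mulVec_smul, mulVec_add] using huw
      refine ⟨a j / r, div_nonneg (hu.1 j) hr.le, ?_⟩
      rw [smul_smul, div_mul_cancel₀ _ hr.ne', ← neg_mulVec_omegaCoeff, smul_neg, ← mulVec_smul,
        ← eq_smul_omegaCoeff_of_add_eq hdiag hij hu hw hab]
    exact fun u hu w hw huw => ⟨key u hu w hw huw, key w hw u hu (by rwa [add_comm])⟩

end

/-- a nonzero `v ∈ F̄` spans an extremal ray of `F̄` (whenever
`u, w ∈ F̄` and `u + w = v`, both `u` and `w` are nonnegative multiples of `v`)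
iff `v` is a positive multiple of some `ω_{îj}` with `i ≠ j`. -/
theorem extremal_rays_of_Fbar
    (n k : ℕ) (hn : 2 ≤ n) (hk : 1 ≤ k)
    (α : Fin k → ℕ) (hα : ∀ i, 0 < α i)
    (l : ℕ) (hl : l = ∑ i, α i) (hl2 : 2 ≤ l) (hexc : ¬(n = 2 ∧ l = 2))
    (blk : Fin l → Fin k) (hmono : Monotone blk)
    (hcard : ∀ j, (Finset.univ.filter fun i => blk i = j).card = α j)
    (B : Matrix (Fin l) (Fin l) ℝ)
    (hB : ∀ i j, B i j =
      if i = j then 1 else if blk i = blk j then -(n : ℝ) else -((n : ℝ) + 1 / 2))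
    (hunit : IsUnit B.det) :
    ∀ v ∈ FbarSet B, v ≠ 0 →
      ((∀ u ∈ FbarSet B, ∀ w ∈ FbarSet B, u + w = v →
          (∃ c : ℝ, 0 ≤ c ∧ u = c • v) ∧ (∃ c : ℝ, 0 ≤ c ∧ w = c • v)) ↔
        ∃ i j : Fin l, i ≠ j ∧ ∃ c : ℝ, 0 < c ∧ v = c • omegaVec B i j) := by
  have hn' : (2 : ℝ) ≤ n := by exact_mod_cast hn
  have hsymm : B.IsSymm := IsSymm.ext fun i j => by
    simp only [hB, eq_comm]
  have hdiag : ∀ i, B i i = 1 := fun i => by rw [hB, if_pos rfl]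
  have hoff : ∀ i j, i ≠ j → B i j < -1 := by
    intro i j hij
    rw [hB, if_neg hij]
    split_ifs <;> linarith
  exact fun v hv hv0 => extremal_iff_of_offDiag_lt hsymm hunit hdiag hoff hv hv0
end

section
/- For every j ∈ {1, …, l−1} and every v ∈ ℝ^l, φ(M′_j · v) = M_j · φ(v). -/
open Matrix

/-- The orthogonal projection `φ(v) = v - (⟨v, e_l⟩ / ⟨e_l, e_l⟩) • e_l`. -/
noncomputable def phiProj {l : ℕ} (B : Matrix (Fin l) (Fin l) ℝ) (el : Fin l → ℝ)
    (v : Fin l → ℝ) : Fin l → ℝ :=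
  v - (bilB B v el / bilB B el el) • el

section Projection

variable {l : ℕ} {B : Matrix (Fin l) (Fin l) ℝ}

theorem bilB_add_smul_left (x y z : Fin l → ℝ) (c : ℝ) :
    bilB B (x + c • y) z = bilB B x z + c * bilB B y z := by
  simp only [bilB, add_dotProduct, smul_dotProduct, smul_eq_mul]
  ring

/-- The projection along `u` is invariant under translation by multiples of `u`. -/
theorem phiProj_add_smul_self {u : Fin l → ℝ} (hu : bilB B u u ≠ 0) (v : Fin l → ℝ) (c : ℝ) :
    phiProj B u (v + c • u) = phiProj B u v := by
  rw [phiProj, bilB_add_smul_left, add_div, mul_div_cancel_right₀ _ hu, add_smul, phiProj]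
  abel

/-- The projection along `u` commutes with translation by vectors orthogonal to `u`. -/
theorem phiProj_add_smul_of_bilB_eq_zero {u w : Fin l → ℝ} (hw : bilB B w u = 0)
    (v : Fin l → ℝ) (c : ℝ) :
    phiProj B u (v + c • w) = phiProj B u v + c • w := by
  rw [phiProj, bilB_add_smul_left, hw, mul_zero, add_zero, phiProj]
  abel

/-- The columns of `B` are dual to the standard basis up to sign. -/
theorem bilB_mulVec_single (hunit : IsUnit B.det) (hsymm : B.IsSymm) {i j : Fin l}
    (hij : i ≠ j) : bilB B (B.mulVec (Pi.single i 1)) (Pi.single j 1) = 0 := by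
  rw [bilB, neg_eq_zero, ← hsymm.eq, mulVec_transpose, hsymm.eq, ← dotProduct_mulVec,
    mulVec_mulVec, mul_nonsing_inv _ hunit, one_mulVec]
  simp [hij]

end Projection

/-- `φ(M′_j · v) = M_j · φ(v)` for all `j ≠ l` and all `v ∈ ℝ^l`. -/
theorem phi_equivariance
    (n k : ℕ) (hn : 2 ≤ n) (hk : 1 ≤ k)
    (α : Fin k → ℕ) (hα : ∀ i, 0 < α i)
    (l : ℕ) (hl : l = ∑ i, α i) (hl3 : 3 ≤ l)
    (blk : Fin l → Fin k) (hmono : Monotone blk)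
    (hcard : ∀ j, (Finset.univ.filter fun i => blk i = j).card = α j)
    (B : Matrix (Fin l) (Fin l) ℝ)
    (hB : ∀ i j, B i j =
      if i = j then 1 else if blk i = blk j then -(n : ℝ) else -((n : ℝ) + 1 / 2))
    (hunit : IsUnit B.det) (hdiag : ∀ i, 0 < B⁻¹ i i)
    (last : Fin l) (hlast : (last : ℕ) = l - 1)
    (el : Fin l → ℝ) (hel : el = Pi.single last 1)
    (hne : bilB B el el ≠ 0)
    (M : Fin l → Matrix (Fin l) (Fin l) ℝ)
    (hM : ∀ j i i', M j i i' =
      if i' = j then (if i = j then -1 else -2 * B i j) else (if i = i' then 1 else 0))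
    (M' : Fin l → Matrix (Fin l) (Fin l) ℝ)
    (hM' : ∀ j i i', M' j i i' = if i = last ∧ i' = j then 0 else M j i i') :
    ∀ j : Fin l, j ≠ last → ∀ v : Fin l → ℝ,
      phiProj B el ((M' j).mulVec v) = (M j).mulVec (phiProj B el v) := by
  intro j hj v
  subst hel
  have hsymm : B.IsSymm := by
    ext i i'
    simp only [transpose_apply, hB, eq_comm]
  have hMv (w : Fin l → ℝ) : (M j).mulVec w = w - (2 * w j) • B.mulVec (Pi.single j 1) := by
    have : M j = 1 - vecMulVec ((2 : ℝ) • B.col j) (Pi.single j 1) := by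
      ext i i'
      by_cases h : i' = j
      · subst h
        by_cases hi : i = i'
        · subst hi
          simp [hM, hB, vecMulVec_apply]
          norm_num
        · simp [hM, vecMulVec_apply, hi]
      · simp [hM, vecMulVec_apply, h, one_apply]
    rw [this, sub_mulVec, one_mulVec, vecMulVec_mulVec, mulVec_single_one]
    ext i
    simp
    ring
  have hM'v : (M' j).mulVec v = (M j).mulVec v + (2 * v j * B last j) • Pi.single last 1 := by
    have : M' j = M j + vecMulVec ((2 * B last j) • Pi.single last 1) (Pi.single j 1) := by
      ext i i'
      by_cases h : i = last ∧ i' = j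
      · obtain ⟨rfl, rfl⟩ := h
        simp [hM', hM, vecMulVec_apply, hj.symm]
      · rw [hM', if_neg h]
        by_cases hi : i = last
        · have hi' : i' ≠ j := fun h' => h ⟨hi, h'⟩
          simp [vecMulVec_apply, hi']
        · simp [vecMulVec_apply, hi]
    rw [this, add_mulVec, vecMulVec_mulVec]
    ext i
    simp
    ring
  have hcoord : phiProj B (Pi.single last 1) v j = v j := by
    simp [phiProj, hj]
  rw [hM'v, phiProj_add_smul_self hne, hMv, hMv, hcoord, sub_eq_add_neg, ← neg_smul,
    phiProj_add_smul_of_bilB_eq_zero (bilB_mulVec_single hunit hsymm hj), neg_smul,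
    ← sub_eq_add_neg]
end

section
/- T̄ ∩ {v ∈ ℝ^l : ⟨v, e_l⟩ = 0} = φ(T̄′), i.e., the intersection of the closure of the Tits cone with the hyperplane orthogonal to e_l equals the image under φ of the closure of the Tits cone of the truncated system. -/
open Matrix

/-- The Tits cone `T = ⋃_{w ∈ W} w(Ā)`, where `Ā` is the cone of nonnegative
coordinate vectors and `W` is the group generated by the involutions `M j`
(every element of `W` is a product of the generators, i.e. a word). -/
def titsCone {l : ℕ} (M : Fin l → Matrix (Fin l) (Fin l) ℝ) : Set (Fin l → ℝ) :=
  {x | ∃ (L : List (Fin l)) (a : Fin l → ℝ),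
    (∀ i, 0 ≤ a i) ∧ x = (L.map M).prod.mulVec a}

/-- The Tits cone `T′ = ⋃_{w ∈ W′} w(Ā′)` of the truncated system: words in the
`M′ j` with `j ≠ last` applied to the cone `Ā′` of nonnegative vectors supported
away from the last coordinate. -/
def titsCone' {l : ℕ} (last : Fin l) (M' : Fin l → Matrix (Fin l) (Fin l) ℝ) :
    Set (Fin l → ℝ) :=
  {x | ∃ L : List (Fin l), (∀ j ∈ L, j ≠ last) ∧ ∃ a : Fin l → ℝ,
    (∀ i, 0 ≤ a i) ∧ a last = 0 ∧ x = (L.map M').prod.mulVec a}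

section Sign

variable {ι κ : Type*} [Fintype ι] [DecidableEq ι] [DecidableEq κ]

/-- A row of `B u` for a matrix `B` with the given block structure. -/
theorem blockMatrix_mulVec_apply {n : ℕ} {blk : ι → κ} {B : Matrix ι ι ℝ}
    (hB : ∀ i j, B i j =
      if i = j then 1 else if blk i = blk j then -(n : ℝ) else -((n : ℝ) + 1 / 2))
    (u : ι → ℝ) (i : ι) :
    (B *ᵥ u) i = (1 + n) * u i + (∑ j with blk j = blk i, u j) / 2
      - (n + 1 / 2) * ∑ j, u j := by
  have h : ∀ j, B i j * u j = (if j = i then (1 + n) * u j else 0)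
      + (if blk j = blk i then u j else 0) / 2 - (n + 1 / 2) * u j := by
    intro j
    rw [hB]
    by_cases hij : i = j
    · subst hij
      simp only [if_true]
      ring
    · simp only [hij, Ne.symm hij, if_false, eq_comm (a := blk j)]
      split_ifs <;> ring
  simp only [mulVec, dotProduct, h, Finset.sum_sub_distrib, Finset.sum_add_distrib,
    ← Finset.sum_div, ← Finset.mul_sum, Finset.sum_filter]
  simp

/-- Off-diagonal entries of the inverse of the block matrix are nonpositive, diagonal ones are
positive: `u` is the column of the inverse indexed by `p`. -/
theorem blockMatrix_inv_col_sign [Fintype κ] {n : ℕ} (hn : 2 ≤ n) (hcard : 3 ≤ Fintype.card ι)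
    {blk : ι → κ} {B : Matrix ι ι ℝ}
    (hB : ∀ i j, B i j =
      if i = j then 1 else if blk i = blk j then -(n : ℝ) else -((n : ℝ) + 1 / 2))
    {p : ι} {u : ι → ℝ} (hu : B *ᵥ u = Pi.single p 1) :
    (∀ j, j ≠ p → u j ≤ 0) ∧ 0 < u p := by
  have hn' : (2 : ℝ) ≤ n := by exact_mod_cast hn
  have hl' : (3 : ℝ) ≤ Fintype.card ι := by exact_mod_cast hcard
  set s := ∑ j, u j with hs
  have hrow : ∀ i, (1 + n) * u i + (∑ j with blk j = blk i, u j) / 2 - (n + 1 / 2) * s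
      = (Pi.single p 1 : ι → ℝ) i := fun i => by rw [← blockMatrix_mulVec_apply hB, hu]
  have hδ : ∀ i, 0 ≤ (Pi.single p 1 : ι → ℝ) i := fun i => by
    by_cases h : i = p
    · subst h; simp
    · simp [h]
  have hblock : ∀ b, (((Finset.univ.filter fun j => blk j = b).card : ℝ)) * ((n + 1 / 2) * s)
      ≤ (n + 1 + ((Finset.univ.filter fun j => blk j = b).card : ℝ) / 2)
        * ∑ j with blk j = b, u j := by
    intro b
    have h : ∑ i with blk i = b, ((1 + n) * u i + (∑ j with blk j = b, u j) / 2
        - (n + 1 / 2) * s) = ∑ i with blk i = b, (Pi.single p 1 : ι → ℝ) i :=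
      Finset.sum_congr rfl fun i hi => by
        rw [← hrow i, (Finset.mem_filter.1 hi).2]
    have h0 : 0 ≤ ∑ i with blk i = b, (Pi.single p 1 : ι → ℝ) i :=
      Finset.sum_nonneg fun i _ => hδ i
    rw [← h, Finset.sum_sub_distrib, Finset.sum_add_distrib, ← Finset.mul_sum,
      Finset.sum_const, Finset.sum_const, nsmul_eq_mul, nsmul_eq_mul] at h0
    linarith
  have hsneg : s < 0 := by
    by_contra! h0
    have hb0 : ∀ b, 0 ≤ ∑ j with blk j = b, u j := fun b => by
      refine nonneg_of_mul_nonneg_right (le_trans ?_ (hblock b)) (by positivity)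
      positivity
    have hb1 : ∀ b, ∑ j with blk j = b, u j ≤ s := fun b => by
      rw [hs, ← Finset.sum_fiberwise Finset.univ blk u]
      exact Finset.single_le_sum (f := fun b => ∑ j with blk j = b, u j)
        (fun b _ => hb0 b) (Finset.mem_univ b)
    have h : ∑ i, ((Pi.single p 1 : ι → ℝ) i + n * s) ≤ ∑ i, (1 + n) * u i :=
      Finset.sum_le_sum fun i _ => by linarith [hrow i, hb1 (blk i)]
    rw [Finset.sum_add_distrib, ← Finset.mul_sum _ u, ← hs, Finset.sum_const, nsmul_eq_mul,
      Finset.sum_pi_single' p (1 : ℝ) Finset.univ, if_pos (Finset.mem_univ p),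
      Finset.card_univ] at h
    nlinarith [mul_nonneg h0 (by linarith : (0 : ℝ) ≤ n),
      mul_le_mul_of_nonneg_right hl' (mul_nonneg (by linarith : (0 : ℝ) ≤ n) h0)]
  have hoff : ∀ j, j ≠ p → u j ≤ 0 := by
    intro j hj
    have h1 := hrow j
    rw [Pi.single_eq_of_ne hj] at h1
    have h2 := hblock (blk j)
    set c : ℝ := ((Finset.univ.filter fun i => blk i = blk j).card : ℝ)
    have hc : 0 ≤ c := Nat.cast_nonneg _
    have h3 : 2 * ((n + 1 / 2) * s) ≤ ∑ i with blk i = blk j, u i := by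
      refine le_of_mul_le_mul_left (le_trans ?_ h2) (by positivity : 0 < (n : ℝ) + 1 + c / 2)
      nlinarith [mul_pos (by positivity : (0 : ℝ) < (n + 1 / 2) * (n + 1)) (neg_pos.2 hsneg)]
    by_contra! h4
    nlinarith
  refine ⟨hoff, ?_⟩
  by_contra! hp
  have hnonpos : ∀ j, u j ≤ 0 := fun j => by
    by_cases h : j = p
    · exact h ▸ hp
    · exact hoff j h
  have hdom : ∀ j, j ≠ p → ∀ i, i ≠ j → u j ≤ 2 * u i := by
    intro j hj i hij
    have h : ∑ m, B j m * u m = 0 := by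
      have := congrFun hu j
      rwa [Pi.single_eq_of_ne hj] at this
    rw [← Finset.add_sum_erase _ _ (Finset.mem_univ j)] at h
    have hterm : ∀ m ∈ Finset.univ.erase j, -2 * u m ≤ B j m * u m := fun m hm => by
      refine mul_le_mul_of_nonpos_right ?_ (hnonpos m)
      rw [hB, if_neg (Finset.ne_of_mem_erase hm).symm]
      split_ifs <;> linarith
    have hi : -2 * u i ≤ ∑ m ∈ Finset.univ.erase j, B j m * u m :=
      (Finset.single_le_sum (f := fun m => -2 * u m) (fun m _ => by linarith [hnonpos m])
        (Finset.mem_erase.2 ⟨hij, Finset.mem_univ i⟩)).trans (Finset.sum_le_sum hterm)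
    have hjj : B j j = 1 := by simp [hB]
    rw [hjj] at h
    linarith
  obtain ⟨j, hj, j', hj', hjj'⟩ : ∃ j ∈ Finset.univ.erase p, ∃ j' ∈ Finset.univ.erase p,
      j ≠ j' := by
    refine Finset.one_lt_card.1 ?_
    rw [Finset.card_erase_of_mem (Finset.mem_univ p), Finset.card_univ]
    omega
  have hjp := Finset.ne_of_mem_erase hj
  have hjp' := Finset.ne_of_mem_erase hj'
  have hj0 : u j = 0 := by
    linarith [hdom j hjp j' hjj'.symm, hdom j' hjp' j hjj', hnonpos j, hnonpos j']
  have hu0 : u = 0 := by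
    funext i
    by_cases h : i = j
    · simpa [h] using hj0
    · have := hdom j hjp i h
      have := hnonpos i
      simp only [Pi.zero_apply]
      linarith
  have := congrFun hu p
  simp [hu0] at this

end Sign

section Word

/-- Every word in involutions can be rewritten as one without equal adjacent letters. -/
theorem exists_isChain_ne_prod_eq {ι G : Type*} [DecidableEq ι] [Monoid G] {M : ι → G}
    (hM : ∀ j, M j * M j = 1)
    (L : List ι) : ∃ L' : List ι, L'.IsChain (· ≠ ·) ∧ (L'.map M).prod = (L.map M).prod := by
  induction L with
  | nil => exact ⟨[], List.isChain_nil, rfl⟩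
  | cons j L ih =>
    obtain ⟨L', hL', h⟩ := ih
    rcases L' with _ | ⟨i, L'⟩
    · exact ⟨[j], List.isChain_singleton j, by simp [← h]⟩
    · by_cases hij : j = i
      · subst hij
        refine ⟨L', hL'.tail, ?_⟩
        rw [List.map_cons, List.prod_cons, ← h, List.map_cons, List.prod_cons, ← mul_assoc, hM,
          one_mul]
      · exact ⟨j :: i :: L', List.isChain_cons_cons.2 ⟨hij, hL'⟩, by simp [← h]⟩

variable {ι : Type*} [Fintype ι] [DecidableEq ι]

/-- A map intertwining generators intertwines words in these generators. -/
theorem word_mulVec_intertwine {M N : ι → Matrix ι ι ℝ} {f : (ι → ℝ) → ι → ℝ} {P : ι → Prop}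
    (hf : ∀ j, P j → ∀ v, f (M j *ᵥ v) = N j *ᵥ f v) (L : List ι) (hL : ∀ j ∈ L, P j)
    (v : ι → ℝ) : f ((L.map M).prod *ᵥ v) = (L.map N).prod *ᵥ f v := by
  induction L with
  | nil => simp
  | cons j L ih =>
    simp only [List.map_cons, List.prod_cons, ← mulVec_mulVec]
    rw [hf j (hL j (by simp)), ih fun i hi => hL i (by simp [hi])]

variable {B : Matrix ι ι ℝ} {M : ι → Matrix ι ι ℝ}

/-- Applying a word without equal adjacent letters and with first letter `j` to a nonnegative
vector makes the `j`-th coordinate nonpositive and all other ones dominate its absolute value. -/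
theorem word_mulVec_sign (hBoff : ∀ i j, i ≠ j → B i j ≤ -1)
    (hMB : ∀ j v i, (M j *ᵥ v) i = if i = j then -v j else v i - 2 * B i j * v j)
    {a : ι → ℝ} (ha : ∀ i, 0 ≤ a i) (L : List ι) (j : ι) (hL : (j :: L).IsChain (· ≠ ·)) :
    (((j :: L).map M).prod *ᵥ a) j ≤ 0 ∧
      ∀ i, i ≠ j → -(((j :: L).map M).prod *ᵥ a) j ≤ (((j :: L).map M).prod *ᵥ a) i := by
  induction L generalizing j with
  | nil =>
    simp only [List.map_cons, List.map_nil, List.prod_cons, List.prod_nil, mul_one, hMB, if_true]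
    refine ⟨by linarith [ha j], fun i hi => ?_⟩
    rw [if_neg hi]
    nlinarith [ha j, ha i, hBoff i j hi]
  | cons m L ih =>
    obtain ⟨hjm, hL⟩ := List.isChain_cons_cons.1 hL
    obtain ⟨hm, hv⟩ := ih m hL
    rw [List.map_cons, List.prod_cons, ← mulVec_mulVec]
    set v := ((m :: L).map M).prod *ᵥ a
    have hj := hv j hjm
    simp only [hMB, if_true]
    refine ⟨by linarith, fun i hi => ?_⟩
    rw [if_neg hi]
    have hB := hBoff i j hi
    have hi' : -v j ≤ v i := by
      by_cases him : i = m
      · subst him; linarith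
      · linarith [hv i him]
    nlinarith

/-- A word without equal adjacent letters applied to a nonnegative vector can be written as a word
avoiding `p` applied to a vector that is nonnegative away from `p`. -/
theorem exists_word_avoiding (hBoff : ∀ i j, i ≠ j → B i j ≤ -1)
    (hMB : ∀ j v i, (M j *ᵥ v) i = if i = j then -v j else v i - 2 * B i j * v j)
    {a : ι → ℝ} (ha : ∀ i, 0 ≤ a i) (p : ι) (L : List ι) (hL : L.IsChain (· ≠ ·)) :
    ∃ L' : List ι, (∀ j ∈ L', j ≠ p) ∧ ∃ y : ι → ℝ, (∀ i, i ≠ p → 0 ≤ y i) ∧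
      (L.map M).prod *ᵥ a = (L'.map M).prod *ᵥ y := by
  induction L with
  | nil => exact ⟨[], by simp, a, fun i _ => ha i, rfl⟩
  | cons j L ih =>
    by_cases hj : j = p
    · subst hj
      obtain ⟨h1, h2⟩ := word_mulVec_sign hBoff hMB ha L j hL
      exact ⟨[], by simp, ((j :: L).map M).prod *ᵥ a,
        fun i hi => (neg_nonneg.2 h1).trans (h2 i hi), by simp⟩
    · obtain ⟨L', hL', y, hy, h⟩ := ih hL.tail
      refine ⟨j :: L', ?_, y, hy, ?_⟩
      · simpa [hj] using hL'
      · simp only [List.map_cons, List.prod_cons, ← mulVec_mulVec, h]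

end Word

/-- `T̄ ∩ {v : ⟨v, e_l⟩ = 0} = φ(T̄′)`. -/
theorem titsCone_cap_hyperplane
    (n k : ℕ) (hn : 2 ≤ n) (hk : 1 ≤ k)
    (α : Fin k → ℕ) (hα : ∀ i, 0 < α i)
    (l : ℕ) (hl : l = ∑ i, α i) (hl3 : 3 ≤ l)
    (blk : Fin l → Fin k) (hmono : Monotone blk)
    (hcard : ∀ j, (Finset.univ.filter fun i => blk i = j).card = α j)
    (B : Matrix (Fin l) (Fin l) ℝ)
    (hB : ∀ i j, B i j =
      if i = j then 1 else if blk i = blk j then -(n : ℝ) else -((n : ℝ) + 1 / 2))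
    (hunit : IsUnit B.det)
    (last : Fin l) (hlast : (last : ℕ) = l - 1)
    (el : Fin l → ℝ) (hel : el = Pi.single last 1)
    (hne : bilB B el el ≠ 0)
    (M : Fin l → Matrix (Fin l) (Fin l) ℝ)
    (hM : ∀ j i i', M j i i' =
      if i' = j then (if i = j then -1 else -2 * B i j) else (if i = i' then 1 else 0))
    (M' : Fin l → Matrix (Fin l) (Fin l) ℝ)
    (hM' : ∀ j i i', M' j i i' = if i = last ∧ i' = j then 0 else M j i i') :
    closure (titsCone M) ∩ {v : Fin l → ℝ | bilB B v el = 0} =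
      phiProj B el '' closure (titsCone' last M') := by
  subst hel
  set u := B⁻¹ *ᵥ Pi.single last 1 with hu
  have hBu : B *ᵥ u = Pi.single last 1 := by
    rw [hu, mulVec_mulVec, mul_nonsing_inv _ hunit, one_mulVec]
  obtain ⟨hoff, hpos⟩ := blockMatrix_inv_col_sign hn (by simpa using hl3) hB hBu
  have hn' : (2 : ℝ) ≤ n := by exact_mod_cast hn
  have hBdiag : ∀ i, B i i = 1 := fun i => by simp [hB]
  have hBoff : ∀ i j, i ≠ j → B i j ≤ -1 := fun i j hij => by
    rw [hB, if_neg hij]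
    split_ifs <;> linarith
  have hBsymm : ∀ i j, B i j = B j i := fun i j => by
    simp only [hB, eq_comm (a := i), eq_comm (a := blk i)]
  have hMB : ∀ j v i, (M j *ᵥ v) i = if i = j then -v j else v i - 2 * B i j * v j := by
    intro j v i
    have h : ∀ m, M j i m * v m = (if m = i then v m else 0)
        + (if m = j then -2 * B i j * v m else 0) := fun m => by
      rw [hM]
      by_cases hmj : m = j
      · subst hmj
        by_cases him : i = m
        · subst him
          simp [hBdiag]
          ring
        · simp [him, Ne.symm him]
      · simp [hmj, eq_comm (a := i)]
    simp only [mulVec, dotProduct, h, Finset.sum_add_distrib, Finset.sum_ite_eq',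
      Finset.mem_univ, if_true]
    split_ifs with hij
    · subst hij
      rw [hBdiag]
      ring
    · ring
  have hMM : ∀ j, M j * M j = 1 := by
    intro j
    refine Matrix.toLin'.injective (LinearMap.ext fun v => funext fun i => ?_)
    simp only [toLin'_apply, ← mulVec_mulVec, hMB, one_mulVec, if_true]
    split_ifs with hij
    · subst hij; ring
    · ring
  have hMB' : ∀ j, j ≠ last → ∀ v i,
      (M' j *ᵥ v) i = if i = last then v last else (M j *ᵥ v) i := by
    intro j hj v i
    split_ifs with hi
    · subst hi
      have h : ∀ m, M' j i m * v m = if m = i then v m else 0 := fun m => by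
        rw [hM', hM]
        by_cases hmj : m = j
        · simp [hmj, hj]
        · simp [hmj, eq_comm (a := i)]
      simp [mulVec, dotProduct, h]
    · simp [mulVec, dotProduct, hM', hi]
  have hbil : ∀ v, bilB B v (Pi.single last 1) = -(v ⬝ᵥ u) := fun v => rfl
  have hsingle : (Pi.single last 1 : Fin l → ℝ) ⬝ᵥ u = u last := by simp
  have hphi : ∀ v, phiProj B (Pi.single last 1) v
      = v - (v ⬝ᵥ u / u last) • (Pi.single last 1 : Fin l → ℝ) := fun v => by
    rw [phiProj, hbil, hbil, hsingle, neg_div_neg_eq]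
  have hphi_add : ∀ v (c : ℝ), phiProj B (Pi.single last 1) (v + c • Pi.single last 1)
      = phiProj B (Pi.single last 1) v := fun v c => by
    rw [hphi, hphi, add_dotProduct, smul_dotProduct, hsingle, smul_eq_mul, add_div,
      mul_div_cancel_right₀ _ hpos.ne', add_smul]
    abel
  have hphi_cont : Continuous (phiProj B (Pi.single last 1)) := by
    have : phiProj B (Pi.single last 1) = fun v : Fin l → ℝ =>
        v - (v ⬝ᵥ u / u last) • (Pi.single last 1 : Fin l → ℝ) := funext hphi
    rw [this]
    unfold dotProduct
    fun_prop
  have hMvec : ∀ j v, M j *ᵥ v = v - (2 * v j) • (fun i => B i j) := fun j v => by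
    funext i
    rw [hMB]
    simp only [Pi.sub_apply, Pi.smul_apply, smul_eq_mul]
    split_ifs with hij
    · subst hij
      rw [hBdiag]
      ring
    · ring
  have hcol : ∀ j, j ≠ last → (fun i => B i j) ⬝ᵥ u = 0 := fun j hj => by
    have h := congrFun hBu j
    rw [Pi.single_eq_of_ne hj] at h
    rw [← h]
    exact Finset.sum_congr rfl fun i _ => congrArg (· * u i) (hBsymm i j)
  have hphiM : ∀ j, j ≠ last → ∀ v,
      phiProj B (Pi.single last 1) (M' j *ᵥ v) = M j *ᵥ phiProj B (Pi.single last 1) v := by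
    intro j hj v
    have h : M' j *ᵥ v
        = M j *ᵥ v + (v last - (M j *ᵥ v) last) • (Pi.single last 1 : Fin l → ℝ) := by
      funext i
      rw [hMB' j hj]
      by_cases hi : i = last
      · subst hi; simp
      · simp [hi]
    rw [h, hphi_add, hphi, hphi, hMvec, hMvec, sub_dotProduct, smul_dotProduct, hcol j hj]
    simp only [smul_zero, sub_zero, Pi.sub_apply, Pi.smul_apply, Pi.single_eq_of_ne hj]
    abel
  have hprojM : ∀ j, j ≠ last → ∀ v : Fin l → ℝ,
      Function.update (M j *ᵥ v) last 0 = M' j *ᵥ Function.update v last 0 := by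
    intro j hj v
    funext i
    rw [hMB' j hj]
    by_cases hi : i = last
    · subst hi; simp
    · simp [hi, hMB, hj]
  apply Set.Subset.antisymm
  · rintro v ⟨hv, hv0⟩
    refine ⟨Function.update v last 0, ?_, ?_⟩
    · refine map_mem_closure (f := fun v : Fin l → ℝ => Function.update v last 0)
        (by fun_prop) hv ?_
      rintro x ⟨L, a, ha, rfl⟩
      obtain ⟨L₁, hL₁, h₁⟩ := exists_isChain_ne_prod_eq hMM L
      obtain ⟨L₂, hL₂, y, hy, h₂⟩ := exists_word_avoiding hBoff hMB ha last L₁ hL₁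
      refine ⟨L₂, hL₂, Function.update y last 0, fun i => ?_, by simp, ?_⟩
      · by_cases hi : i = last
        · subst hi; simp
        · simpa [hi] using hy i hi
      · rw [← h₁, h₂]
        exact word_mulVec_intertwine (f := fun v => Function.update v last 0) hprojM L₂ hL₂ y
    · have h : Function.update v last 0
          = v + (-v last) • (Pi.single last 1 : Fin l → ℝ) := by
        funext i
        by_cases hi : i = last
        · subst hi; simp
        · simp [hi]
      have hv0' : bilB B v (Pi.single last 1) = 0 := hv0
      rw [h, hphi_add, phiProj, hv0', zero_div, zero_smul, sub_zero]
  · rintro _ ⟨v, hv, rfl⟩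
    constructor
    · refine map_mem_closure hphi_cont hv ?_
      rintro x ⟨L, hL, a, ha, ha0, rfl⟩
      refine ⟨L, phiProj B (Pi.single last 1) a, fun i => ?_,
        word_mulVec_intertwine hphiM L hL a⟩
      rw [hphi]
      by_cases hi : i = last
      · subst hi
        have h : a ⬝ᵥ u ≤ 0 := Finset.sum_nonpos fun m _ => by
          by_cases hm : m = i
          · simp [hm, ha0]
          · exact mul_nonpos_of_nonneg_of_nonpos (ha m) (hoff m hm)
        simp only [Pi.sub_apply, Pi.smul_apply, Pi.single_eq_same, smul_eq_mul, mul_one, ha0]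
        linarith [div_nonpos_of_nonpos_of_nonneg h hpos.le]
      · simpa [hi] using ha i
    · change bilB B _ _ = 0
      rw [hphi, hbil, sub_dotProduct, smul_dotProduct, hsingle, smul_eq_mul,
        div_mul_cancel₀ _ hpos.ne', sub_self, neg_zero]
end

section
/- For every natural number m, (M₁·M₂)^m equals the 3×3 matrix with rows (1 − 2m, −2m, 0), (2m, 2m + 1, 0), (6m² − 3m, 6m² + 3m, 1). Equivalently, (M₁M₂)^m sends e₁ to (1 − 2m, 2m, 6m² − 3m), e₂ to (−2m, 2m + 1, 6m² + 3m), and fixes e₃. -/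
open Matrix

/-- The matrix of the birational involution `ι₁*`. -/
noncomputable def M1 : Matrix (Fin 3) (Fin 3) ℝ :=
  !![-1, 0, 0; 2, 1, 0; 3, 0, 1]

/-- The matrix of the birational involution `ι₂*`. -/
noncomputable def M2 : Matrix (Fin 3) (Fin 3) ℝ :=
  !![1, 2, 0; 0, -1, 0; 0, 3, 1]

/-- for every natural number `m`, `(M₁·M₂)^m` has rows
`(1 - 2m, -2m, 0)`, `(2m, 2m + 1, 0)`, `(6m² - 3m, 6m² + 3m, 1)`. -/
theorem pow_M1_M2 :
    ∀ m : ℕ, (M1 * M2) ^ m =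
      !![1 - 2 * (m : ℝ), -2 * (m : ℝ), 0;
         2 * (m : ℝ), 2 * (m : ℝ) + 1, 0;
         6 * (m : ℝ) ^ 2 - 3 * (m : ℝ), 6 * (m : ℝ) ^ 2 + 3 * (m : ℝ), 1] := by
  intro m
  induction m with
  | zero =>
    ext i j
    fin_cases i <;> fin_cases j <;> simp
  | succ k ih =>
    rw [pow_succ, ih, M1, M2]
    ext i j
    fin_cases i <;> fin_cases j <;> simp [Matrix.mul_apply, Fin.sum_univ_three] <;> ring
end

section
/- For every natural number m, (M₁·M₂)^m · M₁ equals the 3×3 matrix with rows (−2m − 1, −2m, 0), (2m + 2, 2m + 1, 0), (6m² + 9m + 3, 6m² + 3m, 1). Equivalently, (M₁M₂)^m M₁ sends e₁ to (−2m − 1, 2m + 2, 6m² + 9m + 3), e₂ to (−2m, 2m + 1, 6m² + 3m), and fixes e₃. -/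
open Matrix

/-- for every natural number `m`, `(M₁·M₂)^m · M₁` has rows
`(-2m - 1, -2m, 0)`, `(2m + 2, 2m + 1, 0)`, `(6m² + 9m + 3, 6m² + 3m, 1)`. -/
theorem pow_M1_M2_mul_M1 :
    ∀ m : ℕ, (M1 * M2) ^ m * M1 =
      !![-2 * (m : ℝ) - 1, -2 * (m : ℝ), 0;
         2 * (m : ℝ) + 2, 2 * (m : ℝ) + 1, 0;
         6 * (m : ℝ) ^ 2 + 9 * (m : ℝ) + 3, 6 * (m : ℝ) ^ 2 + 3 * (m : ℝ), 1] := by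
  intro m
  induction m with
  | zero => simp [M1]
  | succ k ih =>
    rw [pow_succ', Matrix.mul_assoc, ih]
    ext i j
    fin_cases i <;> fin_cases j <;>
      simp [M1, M2, Matrix.mul_apply, Fin.sum_univ_three] <;> ring
end

section
/- The following identity of convergent series holds: (1/10) · Σ_{n=1}^{∞} [ (3n² + 3n + 5/8) / ((3n² + (9/2)n + 1)·(3n² + (3/2)n − 1/2)) + (3n² + 6n + 23/8) / ((3n² + (9/2)n + 1)·(3n² + (15/2)n + 4)) ] = 1/64 + (√33/264) · Σ_{m=0}^{∞} [ 1/(m + 7/4 − √33/12) − 1/(m + 7/4 + √33/12) + 1/(m + 5/4 − √33/12) − 1/(m + 5/4 + √33/12) ]. -/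
open Real

/-- A sequence increasing to `a` has telescoping sum `a - g 0`. -/
lemma hasSum_sub_of_monotone_tendsto {g : ℕ → ℝ} {a : ℝ} (hg : Monotone g)
    (ha : Filter.Tendsto g Filter.atTop (nhds a)) :
    HasSum (fun n => g (n + 1) - g n) (a - g 0) := by
  rw [hasSum_iff_tendsto_nat_of_nonneg fun n => sub_nonneg.2 (hg n.le_succ)]
  simp only [Finset.sum_range_sub]
  exact ha.sub_const _

lemma summable_inv_quadratics :
    Summable (fun n : ℕ =>
      1 / (3 * ((n : ℝ) + 1) ^ 2 + (9 / 2) * ((n : ℝ) + 1) + 1) +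
        1 / (3 * ((n : ℝ) + 1) ^ 2 + (3 / 2) * ((n : ℝ) + 1) - 1 / 2)) := by
  have h : Summable (fun n : ℕ => 1 / ((n : ℝ) + 1) ^ 2) := by
    simpa using (summable_nat_add_iff 1).2 (Real.summable_one_div_nat_pow.2 one_lt_two)
  refine .add (h.of_nonneg_of_le (fun n => ?_) fun n => ?_)
    (h.of_nonneg_of_le (fun n => ?_) fun n => ?_)
  · positivity
  · apply one_div_le_one_div_of_le <;> nlinarith [n.cast_nonneg (α := ℝ)]
  · apply one_div_nonneg.2
    nlinarith [n.cast_nonneg (α := ℝ)]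
  · apply one_div_le_one_div_of_le <;> nlinarith [n.cast_nonneg (α := ℝ)]

/-- The sequence whose differences make up the telescoping part of the volume series. -/
noncomputable def telescopingTerm (n : ℕ) : ℝ :=
  (1 / 8 - (3 / 4) * ((n : ℝ) + 1)) / (3 * ((n : ℝ) + 1) ^ 2 + (3 / 2) * ((n : ℝ) + 1) - 1 / 2)

lemma monotone_telescopingTerm : Monotone telescopingTerm := by
  refine monotone_nat_of_le_succ fun n => ?_
  have hn : (0 : ℝ) ≤ n := n.cast_nonneg
  unfold telescopingTerm
  push_cast
  rw [div_le_div_iff₀ (by nlinarith) (by nlinarith)]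
  nlinarith [pow_nonneg hn 2, pow_nonneg hn 3]

lemma tendsto_telescopingTerm :
    Filter.Tendsto telescopingTerm Filter.atTop (nhds 0) := by
  refine squeeze_zero_norm (fun n => ?_) (tendsto_one_div_add_atTop_nhds_zero_nat (𝕜 := ℝ))
  have hn : (0 : ℝ) ≤ n := n.cast_nonneg
  have hB : 0 < 3 * ((n : ℝ) + 1) ^ 2 + (3 / 2) * ((n : ℝ) + 1) - 1 / 2 := by nlinarith
  rw [telescopingTerm, Real.norm_eq_abs, abs_div, abs_of_pos hB, abs_of_nonpos (by linarith),
    div_le_div_iff₀ hB (by positivity)]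
  nlinarith

lemma hasSum_telescopingTerm :
    HasSum (fun n => telescopingTerm (n + 1) - telescopingTerm n) (5 / 32) := by
  convert hasSum_sub_of_monotone_tendsto monotone_telescopingTerm tendsto_telescopingTerm using 1
  norm_num [telescopingTerm]

lemma volume_summand_eq (n : ℕ) :
    (3 * ((n : ℝ) + 1) ^ 2 + 3 * ((n : ℝ) + 1) + 5 / 8) /
          ((3 * ((n : ℝ) + 1) ^ 2 + (9 / 2) * ((n : ℝ) + 1) + 1) *
            (3 * ((n : ℝ) + 1) ^ 2 + (3 / 2) * ((n : ℝ) + 1) - 1 / 2)) +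
        (3 * ((n : ℝ) + 1) ^ 2 + 6 * ((n : ℝ) + 1) + 23 / 8) /
          ((3 * ((n : ℝ) + 1) ^ 2 + (9 / 2) * ((n : ℝ) + 1) + 1) *
            (3 * ((n : ℝ) + 1) ^ 2 + (15 / 2) * ((n : ℝ) + 1) + 4)) =
      5 / 8 * (1 / (3 * ((n : ℝ) + 1) ^ 2 + (9 / 2) * ((n : ℝ) + 1) + 1) +
        1 / (3 * ((n : ℝ) + 1) ^ 2 + (3 / 2) * ((n : ℝ) + 1) - 1 / 2)) +
      (telescopingTerm (n + 1) - telescopingTerm n) := by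
  have hn : (0 : ℝ) ≤ n := n.cast_nonneg
  have hC : 3 * ((n : ℝ) + 1 + 1) ^ 2 + (3 / 2) * ((n : ℝ) + 1 + 1) - 1 / 2 =
      3 * ((n : ℝ) + 1) ^ 2 + (15 / 2) * ((n : ℝ) + 1) + 4 := by ring
  unfold telescopingTerm
  push_cast
  rw [hC]
  generalize hx : (n : ℝ) + 1 = x
  have hx1 : 1 ≤ x := by linarith
  generalize hA : 3 * x ^ 2 + (9 / 2) * x + 1 = A
  generalize hB : 3 * x ^ 2 + (3 / 2) * x - 1 / 2 = B
  generalize hC : 3 * x ^ 2 + (15 / 2) * x + 4 = C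
  have hA0 : A ≠ 0 := by nlinarith
  have hB0 : B ≠ 0 := by nlinarith
  have hC0 : C ≠ 0 := by nlinarith
  field_simp
  subst hA hB hC
  ring

lemma digamma_summand_eq (m : ℕ) :
    1 / ((m : ℝ) + 7 / 4 - Real.sqrt 33 / 12) -
        1 / ((m : ℝ) + 7 / 4 + Real.sqrt 33 / 12) +
        1 / ((m : ℝ) + 5 / 4 - Real.sqrt 33 / 12) -
        1 / ((m : ℝ) + 5 / 4 + Real.sqrt 33 / 12) =
      Real.sqrt 33 / 2 * (1 / (3 * ((m : ℝ) + 1) ^ 2 + (9 / 2) * ((m : ℝ) + 1) + 1) +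
        1 / (3 * ((m : ℝ) + 1) ^ 2 + (3 / 2) * ((m : ℝ) + 1) - 1 / 2)) := by
  have hm : (0 : ℝ) ≤ m := m.cast_nonneg
  have hs : Real.sqrt 33 ^ 2 = 33 := Real.sq_sqrt (by norm_num)
  have hs0 : 0 ≤ Real.sqrt 33 := Real.sqrt_nonneg 33
  have hs6 : Real.sqrt 33 < 6 := by nlinarith
  have key (y : ℝ) (hy : 1 ≤ y) :
      1 / (y - Real.sqrt 33 / 12) - 1 / (y + Real.sqrt 33 / 12) =
        Real.sqrt 33 / 2 * (1 / (3 * y ^ 2 - 11 / 16)) := by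
    have hP : 3 * y ^ 2 - 11 / 16 = 3 * ((y - Real.sqrt 33 / 12) * (y + Real.sqrt 33 / 12)) := by
      linear_combination (1 / 48 : ℝ) * hs
    have h₁ : y - Real.sqrt 33 / 12 ≠ 0 := by linarith
    have h₂ : y + Real.sqrt 33 / 12 ≠ 0 := by linarith
    rw [hP, div_sub_div _ _ h₁ h₂, mul_one_div, div_eq_div_iff (by positivity) (by positivity)]
    ring
  have h₇ := key (m + 7 / 4) (by linarith)
  have h₅ := key (m + 5 / 4) (by linarith)
  rw [add_sub_assoc, h₇, h₅, ← mul_add]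
  ring_nf

/-- the series identity
`(1/10)·Σ_{n≥1} [ (3n²+3n+5/8)/((3n²+(9/2)n+1)(3n²+(3/2)n−1/2))
               + (3n²+6n+23/8)/((3n²+(9/2)n+1)(3n²+(15/2)n+4)) ]
 = 1/64 + (√33/264)·Σ_{m≥0} [ 1/(m+7/4−√33/12) − 1/(m+7/4+√33/12)
                            + 1/(m+5/4−√33/12) − 1/(m+5/4+√33/12) ]`,
both series being convergent. -/
theorem volume_series_digamma :
    Summable (fun n : ℕ =>
      (3 * ((n : ℝ) + 1) ^ 2 + 3 * ((n : ℝ) + 1) + 5 / 8) /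
          ((3 * ((n : ℝ) + 1) ^ 2 + (9 / 2) * ((n : ℝ) + 1) + 1) *
            (3 * ((n : ℝ) + 1) ^ 2 + (3 / 2) * ((n : ℝ) + 1) - 1 / 2)) +
        (3 * ((n : ℝ) + 1) ^ 2 + 6 * ((n : ℝ) + 1) + 23 / 8) /
          ((3 * ((n : ℝ) + 1) ^ 2 + (9 / 2) * ((n : ℝ) + 1) + 1) *
            (3 * ((n : ℝ) + 1) ^ 2 + (15 / 2) * ((n : ℝ) + 1) + 4))) ∧
    Summable (fun m : ℕ =>
      1 / ((m : ℝ) + 7 / 4 - Real.sqrt 33 / 12) -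
        1 / ((m : ℝ) + 7 / 4 + Real.sqrt 33 / 12) +
        1 / ((m : ℝ) + 5 / 4 - Real.sqrt 33 / 12) -
        1 / ((m : ℝ) + 5 / 4 + Real.sqrt 33 / 12)) ∧
    (1 / 10) * (∑' n : ℕ,
      ((3 * ((n : ℝ) + 1) ^ 2 + 3 * ((n : ℝ) + 1) + 5 / 8) /
          ((3 * ((n : ℝ) + 1) ^ 2 + (9 / 2) * ((n : ℝ) + 1) + 1) *
            (3 * ((n : ℝ) + 1) ^ 2 + (3 / 2) * ((n : ℝ) + 1) - 1 / 2)) +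
        (3 * ((n : ℝ) + 1) ^ 2 + 6 * ((n : ℝ) + 1) + 23 / 8) /
          ((3 * ((n : ℝ) + 1) ^ 2 + (9 / 2) * ((n : ℝ) + 1) + 1) *
            (3 * ((n : ℝ) + 1) ^ 2 + (15 / 2) * ((n : ℝ) + 1) + 4)))) =
      1 / 64 + (Real.sqrt 33 / 264) * (∑' m : ℕ,
        (1 / ((m : ℝ) + 7 / 4 - Real.sqrt 33 / 12) -
          1 / ((m : ℝ) + 7 / 4 + Real.sqrt 33 / 12) +
          1 / ((m : ℝ) + 5 / 4 - Real.sqrt 33 / 12) -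
          1 / ((m : ℝ) + 5 / 4 + Real.sqrt 33 / 12))) := by
  have hsum := summable_inv_quadratics
  have htel := hasSum_telescopingTerm
  simp_rw [volume_summand_eq, digamma_summand_eq]
  refine ⟨(hsum.mul_left _).add htel.summable, hsum.mul_left _, ?_⟩
  rw [(hsum.mul_left _).tsum_add htel.summable, tsum_mul_left, tsum_mul_left, htel.tsum_eq]
  have hs : Real.sqrt 33 ^ 2 = 33 := Real.sq_sqrt (by norm_num)
  generalize ∑' n : ℕ, (_ : ℝ) = S
  linear_combination (-S / 528) * hs
end
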